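/- Let (R, m, k) be a complete n-dimensional Gorenstein local ring and I ⊂ R an ideal with c = height I and d = dim R/I. Then the following conditions are equivalent: (i) Ext_R^c(H^c_I(R), R) is a finitely generated R-module; (ii) dim_k Hom_R(k, H^d_m(H^c_I(R))) < ∞; (iii) H^d_m(H^c_I(R)) is an Artinian R-module. -/

import Mathlib

open CategoryTheory CategoryTheory.Limits Opposite IsLocalRing

noncomputable section

universe u

/-- The `i`-th local cohomology of the `R`-module `M` with support in the ideal `J`,
defined (following Mathlib) as the direct limit of `Ext^i(R/J^α, M)`. -/
abbrev LC (R : Type u) [CommRing R] (J : Ideal R) (i : ℕ) (M : ModuleCat.{u} R) :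
    ModuleCat.{u} R :=
  (localCohomology J i).obj M

/-- `Ext^i_R(M, N)` as an `R`-module. -/
abbrev ExtM (R : Type u) [CommRing R] (i : ℕ) (M N : ModuleCat.{u} R) : ModuleCat.{u} R :=
  ((Ext R (ModuleCat.{u} R) i).obj (op M)).obj N

/-- The height of an ideal: the infimum of the heights of the primes containing it. -/
def idealHeight (R : Type u) [CommRing R] (I : Ideal R) : ℕ∞ :=
  ⨅ p : {p : PrimeSpectrum R // I ≤ p.asIdeal}, Order.height (p : PrimeSpectrum R)

/-- A Noetherian local ring `(R, 𝔪, k)` is Gorenstein if `Ext^i_R(k, R)` vanishes for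
`i ≠ dim R` and is isomorphic to `k` in degree `dim R`. -/
def IsGorensteinLocalRing (R : Type u) [CommRing R] [IsLocalRing R] : Prop :=
  IsNoetherianRing R ∧
    ∃ n : ℕ, ringKrullDim R = n ∧
      (∀ i : ℕ, i ≠ n →
        Subsingleton (ExtM R i (ModuleCat.of R (R ⧸ maximalIdeal R)) (ModuleCat.of R R))) ∧
      Nonempty ((ExtM R n (ModuleCat.of R (R ⧸ maximalIdeal R)) (ModuleCat.of R R)) ≃ₗ[R]
        (R ⧸ maximalIdeal R))


section

variable {R : Type u} [CommRing R] {X Y : ModuleCat.{u} R}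

/-- The cocycles of degree `n` of `Hom(P, Y)`. -/
def cocyclesHom (P : ProjectiveResolution X) (Y : ModuleCat.{u} R) (n : ℕ) :
    Submodule R (P.complex.X n ⟶ Y) :=
  LinearMap.ker (Linear.leftComp R Y (P.complex.d (n + 1) n))

lemma mem_cocyclesHom {P : ProjectiveResolution X} {n : ℕ} {f : P.complex.X n ⟶ Y} :
    f ∈ cocyclesHom P Y n ↔ P.complex.d (n + 1) n ≫ f = 0 := Iff.rfl

/-- The class in `Ext` of a cocycle of a projective resolution. -/
def extOfCocycles (P : ProjectiveResolution X) (Y : ModuleCat.{u} R) (n : ℕ) :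
    cocyclesHom P Y n →ₗ[R] Abelian.Ext X Y n where
  toFun z := P.extMk z.1 (n + 1) rfl (mem_cocyclesHom.1 z.2)
  map_add' x y := by
    rw [P.add_extMk]
    rfl
  map_smul' r x := by
    dsimp
    rw [Abelian.Ext.smul_eq_comp_mk₀, P.extMk_comp_mk₀]
    congr 1

lemma extOfCocycles_surjective (P : ProjectiveResolution X) (Y : ModuleCat.{u} R) (n : ℕ) :
    Function.Surjective (extOfCocycles P Y n) := fun α ↦ by
  obtain ⟨f, hf, rfl⟩ := P.extMk_surjective α (n + 1) rfl
  exact ⟨⟨f, mem_cocyclesHom.2 hf⟩, rfl⟩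

/-- The cycles of `Hom(P, Y)` as elements of `cocyclesHom`. -/
def cyclesToCocycles (P : ProjectiveResolution X) (Y : ModuleCat.{u} R) (n : ℕ) :
    (P.complex.linearYonedaObj R Y).cycles n →ₗ[R] cocyclesHom P Y n :=
  LinearMap.codRestrict (cocyclesHom P Y n)
    ((P.complex.linearYonedaObj R Y).iCycles n).hom fun z ↦ by
      have := (P.complex.linearYonedaObj R Y).iCycles_d n (n + 1)
      rw [mem_cocyclesHom]
      exact congr($this z)

lemma iCycles_injective {ι : Type*} {c : ComplexShape ι}
    (K : HomologicalComplex (ModuleCat.{u} R) c) (n : ι) : Function.Injective (K.iCycles n) :=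
  (ModuleCat.mono_iff_injective _).1 inferInstance

lemma homologyπ_surjective {ι : Type*} {c : ComplexShape ι}
    (K : HomologicalComplex (ModuleCat.{u} R) c) (n : ι) : Function.Surjective (K.homologyπ n) :=
  (ModuleCat.epi_iff_surjective _).1 inferInstance

lemma homologyπ_eq_zero_iff (K : CochainComplex (ModuleCat.{u} R) ℕ) (n : ℕ) (z : K.cycles n) :
    K.homologyπ n z = 0 ↔ ∃ x, K.toCycles ((ComplexShape.up ℕ).prev n) n x = z :=
  ((ShortComplex.ShortExact.moduleCat_exact_iff_function_exact _).1
    (ShortComplex.exact_of_g_is_cokernel (ShortComplex.mk _ _ (K.toCycles_comp_homologyπ _ n))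
      (K.homologyIsCokernel _ n rfl)) z)

lemma mem_range_iCycles (K : CochainComplex (ModuleCat.{u} R) ℕ) (n : ℕ) (x : K.X n)
    (hx : K.d n (n + 1) x = 0) : ∃ z, K.iCycles n z = x :=
  ((ShortComplex.ShortExact.moduleCat_exact_iff_function_exact _).1
    (ShortComplex.exact_of_f_is_kernel (ShortComplex.mk _ _ (K.iCycles_d n (n + 1)))
      (K.cyclesIsKernel n _ (by simp))) x).1 hx

lemma cyclesToCocycles_surjective (P : ProjectiveResolution X) (Y : ModuleCat.{u} R) (n : ℕ) :
    Function.Surjective (cyclesToCocycles P Y n) := fun ⟨f, hf⟩ ↦ by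
  obtain ⟨z, hz⟩ := mem_range_iCycles (P.complex.linearYonedaObj R Y) n f hf
  exact ⟨z, Subtype.ext hz⟩

open CochainComplex HomComplex in
lemma extMk_zero_degree_eq_zero (P : ProjectiveResolution X) (f : P.complex.X 0 ⟶ Y)
    (hf : P.complex.d 1 0 ≫ f = 0) (h : P.extMk f 1 rfl hf = 0) : f = 0 := by
  rw [← P.extEquivCohomologyClass.apply_eq_iff_eq,
    P.extEquivCohomologyClass_extMk, P.extEquivCohomologyClass_zero,
    CohomologyClass.mk_eq_zero_iff,
    Cocycle.toSingleMk_mem_coboundaries_iff _ _ _ _ _ 1 (by lia)] at h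
  obtain ⟨g, hg⟩ := h
  have : g = 0 := (P.cochainComplex.isZero_of_isStrictlyLE 0 1 (by lia)).eq_of_src _ _
  rw [this, comp_zero, eq_comm] at hg
  rw [← cancel_epi (P.cochainComplexXIso (-0) 0 rfl).hom]
  exact hg.trans comp_zero.symm

lemma extOfCocycles_eq_zero_iff (P : ProjectiveResolution X) (n : ℕ)
    (z : (P.complex.linearYonedaObj R Y).cycles n) :
    extOfCocycles P Y n (cyclesToCocycles P Y n z) = 0 ↔
      (P.complex.linearYonedaObj R Y).homologyπ n z = 0 := by
  rw [homologyπ_eq_zero_iff]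
  cases n with
  | zero =>
    rw [HomologicalComplex.toCycles_eq_zero _ (by simp)]
    constructor
    · intro h
      refine ⟨0, iCycles_injective _ _ ?_⟩
      refine Eq.trans (by simp; rfl) (extMk_zero_degree_eq_zero P _ (mem_cocyclesHom.1
        (cyclesToCocycles P Y 0 z).2) h).symm
    · rintro ⟨x, rfl⟩
      simp
  | succ n =>
    rw [CochainComplex.prev_nat_succ]
    refine (P.extMk_eq_zero_iff _ (n + 2) rfl
      (mem_cocyclesHom.1 (cyclesToCocycles P Y (n + 1) z).2) n rfl).trans ?_
    constructor
    · rintro ⟨g, hg⟩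
      refine ⟨g, iCycles_injective _ _ ?_⟩
      refine Eq.trans ?_ hg
      exact congr($((P.complex.linearYonedaObj R Y).toCycles_i n (n + 1)) g)
    · rintro ⟨g, rfl⟩
      refine ⟨g, ?_⟩
      exact (congr($((P.complex.linearYonedaObj R Y).toCycles_i n (n + 1)) g)).symm

def homologyEquivExt (P : ProjectiveResolution X) (Y : ModuleCat.{u} R) (n : ℕ) :
    (P.complex.linearYonedaObj R Y).homology n ≃ₗ[R] Abelian.Ext X Y n :=
  (LinearMap.quotKerEquivOfSurjective ((P.complex.linearYonedaObj R Y).homologyπ n).hom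
      (homologyπ_surjective _ _)).symm ≪≫ₗ
    Submodule.quotEquivOfEq _ (LinearMap.ker (extOfCocycles P Y n ∘ₗ cyclesToCocycles P Y n))
      (by ext z; exact (extOfCocycles_eq_zero_iff P n z).symm) ≪≫ₗ
    LinearMap.quotKerEquivOfSurjective _
      ((extOfCocycles_surjective P Y n).comp (cyclesToCocycles_surjective P Y n))

lemma homologyEquivExt_homologyπ (P : ProjectiveResolution X) (n : ℕ)
    (z : (P.complex.linearYonedaObj R Y).cycles n) :
    homologyEquivExt P Y n ((P.complex.linearYonedaObj R Y).homologyπ n z) =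
      extOfCocycles P Y n (cyclesToCocycles P Y n z) := by
  have : (LinearMap.quotKerEquivOfSurjective ((P.complex.linearYonedaObj R Y).homologyπ n).hom
      (homologyπ_surjective _ _)).symm ((P.complex.linearYonedaObj R Y).homologyπ n z) =
      Submodule.Quotient.mk z := by
    rw [LinearEquiv.symm_apply_eq]; rfl
  rw [homologyEquivExt, LinearEquiv.trans_apply, LinearEquiv.trans_apply, this]
  rfl

/-- Precomposition with a morphism of complexes. -/
def linearYonedaObjMap {P P' : ChainComplex (ModuleCat.{u} R) ℕ} (φ : P' ⟶ P)
    (Y : ModuleCat.{u} R) : P.linearYonedaObj R Y ⟶ P'.linearYonedaObj R Y :=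
  (HomologicalComplex.unopFunctor _ _).map
    (((((linearYoneda R (ModuleCat.{u} R)).obj Y).rightOp.mapHomologicalComplex _).map φ).op)

lemma homologyEquivExt_naturality {X' : ModuleCat.{u} R} {P : ProjectiveResolution X}
    {P' : ProjectiveResolution X'}
    {g : X' ⟶ X} (φ : ProjectiveResolution.Hom P' P g) (n : ℕ)
    (x : (P.complex.linearYonedaObj R Y).homology n) :
    homologyEquivExt P' Y n (HomologicalComplex.homologyMap (linearYonedaObjMap φ.hom Y) n x) =
      (Abelian.Ext.mk₀ g).comp (homologyEquivExt P Y n x) (zero_add n) := by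
  obtain ⟨z, rfl⟩ := homologyπ_surjective _ _ x
  have h1 : HomologicalComplex.homologyMap (linearYonedaObjMap φ.hom Y) n
      ((P.complex.linearYonedaObj R Y).homologyπ n z) =
      (P'.complex.linearYonedaObj R Y).homologyπ n
        (HomologicalComplex.cyclesMap (linearYonedaObjMap φ.hom Y) n z) :=
    congr($(HomologicalComplex.homologyπ_naturality (linearYonedaObjMap φ.hom Y) n) z)
  rw [h1, homologyEquivExt_homologyπ, homologyEquivExt_homologyπ]
  refine Eq.trans ?_ (ProjectiveResolution.mk₀_comp_extMk _ _ rfl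
    (mem_cocyclesHom.1 (cyclesToCocycles P Y n z).2) φ).symm
  have h2 : (P'.complex.linearYonedaObj R Y).iCycles n
        (HomologicalComplex.cyclesMap (linearYonedaObjMap φ.hom Y) n z) =
      (linearYonedaObjMap φ.hom Y).f n ((P.complex.linearYonedaObj R Y).iCycles n z) :=
    congr($(HomologicalComplex.cyclesMap_i (linearYonedaObjMap φ.hom Y) n) z)
  dsimp only [extOfCocycles, LinearMap.coe_mk, AddHom.coe_mk]
  congr 1

lemma comp_comp_eq {C : Type*} [Category* C] {a b c a' b' c' : C} {A : a ⟶ a'}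
    {i' : a' ⟶ b'} {i : a ⟶ b} {G : b ⟶ b'} {u' : b' ⟶ c'} {v : b ⟶ c} {H : c ⟶ c'}
    (h : A ≫ i' = i ≫ G) (h' : G ≫ u' = v ≫ H) : A ≫ i' ≫ u' = (i ≫ v) ≫ H := by
  rw [← Category.assoc, h, Category.assoc, h', Category.assoc]

lemma inv_comp_eq_comp_inv {C : Type*} [Category* C] {a b a' b' : C} (α : a ≅ b)
    (β : a' ≅ b') {f : a ⟶ a'} {g : b ⟶ b'} (h : f ≫ β.hom = α.hom ≫ g) :
    α.inv ≫ f = g ≫ β.inv := by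
  rw [Iso.inv_comp_eq, ← Category.assoc, ← h, Category.assoc, Iso.hom_inv_id, Category.comp_id]

lemma homologyOp_inv_naturality {K L : CochainComplex (ModuleCat.{u} R) ℕ} (φ : K ⟶ L) (n : ℕ) :
    (HomologicalComplex.homologyMap ((HomologicalComplex.opFunctor _ _).map φ.op) n).unop ≫
      (L.homologyOp n).inv.unop =
    (K.homologyOp n).inv.unop ≫ HomologicalComplex.homologyMap φ n := by
  have := inv_comp_eq_comp_inv (L.homologyOp n) (K.homologyOp n)
    (HomologicalComplex.homologyOp_hom_naturality φ n)
  exact congr(Quiver.Hom.unop $this)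

lemma isoExt_naturality {X' : ModuleCat.{u} R} {P : ProjectiveResolution X}
    {P' : ProjectiveResolution X'} {g : X' ⟶ X} (φ : ProjectiveResolution.Hom P' P g) (n : ℕ) :
    ((Ext R (ModuleCat.{u} R) n).map g.op).app Y ≫ (P'.isoExt (R := R) n Y).hom =
      (P.isoExt n Y).hom ≫ HomologicalComplex.homologyMap (linearYonedaObjMap φ.hom Y) n := by
  have h1 := P'.isoLeftDerivedObj_inv_naturality g P φ.hom φ.hom_f_zero_comp_π_f_zero
    ((linearYoneda R (ModuleCat.{u} R)).obj Y).rightOp n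
  have h2 := congr(Quiver.Hom.unop $h1)
  rw [unop_comp, unop_comp] at h2
  have h3 := homologyOp_inv_naturality (linearYonedaObjMap φ.hom Y) n
  exact comp_comp_eq h2 h3

/-- The two models of `Ext` agree. -/
def extEquiv (X Y : ModuleCat.{u} R) (n : ℕ) : ExtM R n X Y ≃ₗ[R] Abelian.Ext X Y n :=
  ((projectiveResolution X).isoExt n Y).toLinearEquiv ≪≫ₗ
    homologyEquivExt (projectiveResolution X) Y n

lemma extEquiv_naturality {X' : ModuleCat.{u} R} (g : X' ⟶ X) (n : ℕ) (x : ExtM R n X Y) :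
    extEquiv X' Y n (((Ext R (ModuleCat.{u} R) n).map g.op).app Y x) =
      (Abelian.Ext.mk₀ g).comp (extEquiv X Y n x) (zero_add n) := by
  let φ : ProjectiveResolution.Hom (projectiveResolution X') (projectiveResolution X) g :=
    { hom := ProjectiveResolution.lift g _ _
      hom_f_zero_comp_π_f_zero :=
        congr(HomologicalComplex.Hom.f $(ProjectiveResolution.lift_commutes g _ _) 0) }
  refine Eq.trans ?_ (homologyEquivExt_naturality φ n _)
  exact congr(homologyEquivExt (projectiveResolution X') Y n ($(isoExt_naturality φ n) x))

end

section

variable {R : Type u} [CommRing R]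

/-- `R ⧸ J ^ t` as an object of the category of modules. -/
abbrev quotPow (J : Ideal R) (t : ℕ) : ModuleCat.{u} R := ModuleCat.of R (R ⧸ J ^ t)

/-- The projection `R ⧸ J ^ t' → R ⧸ J ^ t` for `t ≤ t'`. -/
def quotPowMap (J : Ideal R) {t t' : ℕ} (h : t ≤ t') : quotPow J t' ⟶ quotPow J t :=
  ModuleCat.ofHom (Submodule.mapQ _ _ LinearMap.id (Ideal.pow_le_pow_right h))

/-- The transition maps in the direct system defining local cohomology. -/
def extTrans (J : Ideal R) (j : ℕ) (M : ModuleCat.{u} R) (t t' : ℕ) (h : t ≤ t') :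
    Abelian.Ext.{u} (quotPow J t) M j →ₗ[R] Abelian.Ext.{u} (quotPow J t') M j :=
  (Abelian.Ext.mk₀ (quotPowMap J h)).precompOfLinear R M (zero_add j)

lemma quotPowMap_self (J : Ideal R) (t : ℕ) : quotPowMap J (le_refl t) = 𝟙 _ := by
  ext
  rfl

lemma quotPowMap_comp (J : Ideal R) {t t' t'' : ℕ} (h : t ≤ t') (h' : t' ≤ t'') :
    quotPowMap J h' ≫ quotPowMap J h = quotPowMap J (h.trans h') := by
  ext
  rfl

lemma extTrans_apply (J : Ideal R) (j : ℕ) (M : ModuleCat.{u} R) {t t' : ℕ} (h : t ≤ t')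
    (x : Abelian.Ext.{u} (quotPow J t) M j) :
    extTrans J j M t t' h x = (Abelian.Ext.mk₀ (quotPowMap J h)).comp x (zero_add j) := rfl

instance (J : Ideal R) (j : ℕ) (M : ModuleCat.{u} R) :
    DirectedSystem (fun t ↦ Abelian.Ext.{u} (quotPow J t) M j)
      (fun t t' h ↦ extTrans J j M t t' h) where
  map_self t x := by
    rw [extTrans_apply, quotPowMap_self, Abelian.Ext.mk₀_id_comp]
  map_map i t t' h h' x := by
    rw [extTrans_apply, extTrans_apply, extTrans_apply, Abelian.Ext.mk₀_comp_mk₀_assoc,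
      quotPowMap_comp]

/-- Local cohomology as a concrete direct limit of modules `Ext^j(R ⧸ J ^ t, M)`. -/
abbrev LCoh (J : Ideal R) (j : ℕ) (M : ModuleCat.{u} R) : Type u :=
  Module.DirectLimit (fun t ↦ Abelian.Ext.{u} (quotPow J t) M j) (extTrans J j M)

/-- The canonical map from `Ext^j(R ⧸ J ^ t, M)` to local cohomology. -/
abbrev LCoh.of (J : Ideal R) (j : ℕ) (M : ModuleCat.{u} R) (t : ℕ) :
    Abelian.Ext.{u} (quotPow J t) M j →ₗ[R] LCoh J j M :=
  Module.DirectLimit.of R ℕ _ (extTrans J j M) t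

section

variable {F : ℕᵒᵖᵒᵖ ⥤ ModuleCat.{u} R} {s : Cocone F} {G : ℕ → Type u}
  [∀ t, AddCommGroup (G t)] [∀ t, Module R (G t)] {f : ∀ t t', t ≤ t' → G t →ₗ[R] G t'}
  (e : ∀ t, F.obj (op (op t)) ≃ₗ[R] G t)

lemma cocone_app_symm
    (comm : ∀ t t' (h : t ≤ t') (φ : (op (op t) : ℕᵒᵖᵒᵖ) ⟶ op (op t')) (x : F.obj (op (op t))),
      e t' (F.map φ x) = f t t' h (e t x))
    {t t' : ℕ} (h : t ≤ t') (x : G t) :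
    s.ι.app (op (op t')) ((e t').symm (f t t' h x)) = s.ι.app (op (op t)) ((e t).symm x) := by
  obtain ⟨x, rfl⟩ := (e t).surjective x
  let φ : (op (op t) : ℕᵒᵖᵒᵖ) ⟶ op (op t') := (homOfLE h).op.op
  rw [← comm t t' h φ, LinearEquiv.symm_apply_apply, LinearEquiv.symm_apply_apply]
  exact congr($(s.w φ) x)

variable (comm : ∀ t t' (h : t ≤ t') (φ : (op (op t) : ℕᵒᵖᵒᵖ) ⟶ op (op t'))
  (x : F.obj (op (op t))), e t' (F.map φ x) = f t t' h (e t x))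

/-- The comparison of the direct limit of modules with a colimit in the category of modules. -/
def directLimitToColimit : Module.DirectLimit G f →ₗ[R] s.pt :=
  Module.DirectLimit.lift _ _ _ _
    (fun t ↦ (s.ι.app (op (op t))).hom ∘ₗ ((e t).symm : G t →ₗ[R] F.obj (op (op t))))
    fun _ _ h x ↦ cocone_app_symm e comm h x

lemma directLimitToColimit_bijective [DirectedSystem G fun i j h ↦ f i j h]
    (hs : IsColimit s) : Function.Bijective (directLimitToColimit (s := s) e comm) := by
  have : PreservesFilteredColimitsOfSize.{0, 0} (forget (ModuleCat.{u} R)) :=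
    preservesSmallestFilteredColimits_of_preservesFilteredColimits _
  constructor
  · rw [injective_iff_map_eq_zero]
    intro z hz
    obtain ⟨t, x, rfl⟩ := Module.DirectLimit.exists_of z
    rw [directLimitToColimit, Module.DirectLimit.lift_of] at hz
    obtain ⟨k, φ, ψ, hk⟩ := Concrete.isColimit_exists_of_rep_eq _ hs ((e t).symm x) 0
      (hz.trans (map_zero (s.ι.app (op (op t))).hom).symm)
    obtain ⟨t', rfl⟩ : ∃ t', k = op (op t') := ⟨k.unop.unop, rfl⟩
    have hle : t ≤ t' := leOfHom φ.unop.unop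
    have h1 := congr(e t' $hk)
    rw [comm t t' hle, LinearEquiv.apply_symm_apply, map_zero, map_zero] at h1
    rw [← Module.DirectLimit.of_f (hij := hle), h1, map_zero]
  · intro z
    obtain ⟨k, y, rfl⟩ := Concrete.isColimit_exists_rep _ hs z
    obtain ⟨t, rfl⟩ : ∃ t, k = op (op t) := ⟨k.unop.unop, rfl⟩
    refine ⟨Module.DirectLimit.of R ℕ G f t (e t y), ?_⟩
    rw [directLimitToColimit, Module.DirectLimit.lift_of]
    simp

end

/-- The concrete model of local cohomology agrees with Mathlib's. -/
def lcohEquiv (J : Ideal R) (j : ℕ) (M : ModuleCat.{u} R) : LCoh J j M ≃ₗ[R] LC R J j M :=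
  LinearEquiv.ofBijective _ (directLimitToColimit_bijective
    (F := localCohomology.diagram (localCohomology.idealPowersDiagram J) j ⋙ (evaluation _ _).obj M)
    (f := extTrans J j M) (fun t ↦ extEquiv (quotPow J t) M j) (fun _ _ h _ x ↦
      extEquiv_naturality (quotPowMap J h) j x)
    (isColimitOfPreserves ((evaluation _ _).obj M)
      (colimit.isColimit (localCohomology.diagram (localCohomology.idealPowersDiagram J) j))))

end

section

variable {R : Type u} [CommRing R]

open CategoryTheory.Abelian (Ext)

namespace LCoh

variable {J : Ideal R} {M M' M'' : ModuleCat.{u} R}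

lemma of_trans {j t t' : ℕ} (h : t ≤ t') (x : Ext.{u} (quotPow J t) M j) :
    of J j M t' ((Ext.mk₀ (quotPowMap J h)).comp x (zero_add j)) = of J j M t x :=
  Module.DirectLimit.of_f (f := extTrans J j M) (hij := h)

lemma post_compat {i : ℕ} (ξ : Ext.{u} M M' i) {j l : ℕ} (h : j + i = l) (t t' : ℕ)
    (ht : t ≤ t') (x : Ext.{u} (quotPow J t) M j) :
    (of J l M' t' ∘ₗ ξ.postcompOfLinear R (quotPow J t') h) (extTrans J j M t t' ht x) =
      (of J l M' t ∘ₗ ξ.postcompOfLinear R (quotPow J t) h) x := by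
  simp only [LinearMap.comp_apply, LinearMap.flip_apply, Ext.bilinearCompOfLinear_apply_apply]
  rw [extTrans_apply, ← of_trans ht, Ext.comp_assoc _ x ξ (zero_add j) h (by lia)]

/-- Composition with an extension class acts on local cohomology. -/
def post (J : Ideal R) {i : ℕ} (ξ : Ext.{u} M M' i) {j l : ℕ} (h : j + i = l) :
    LCoh J j M →ₗ[R] LCoh J l M' :=
  Module.DirectLimit.lift _ _ _ _ (fun t ↦ of J l M' t ∘ₗ ξ.postcompOfLinear R (quotPow J t) h)
    (post_compat ξ h)

lemma post_of {i : ℕ} (ξ : Ext.{u} M M' i) {j l : ℕ} (h : j + i = l) (t : ℕ)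
    (x : Ext.{u} (quotPow J t) M j) :
    post J ξ h (of J j M t x) = of J l M' t (x.comp ξ h) := by
  rw [post, Module.DirectLimit.lift_of, LinearMap.comp_apply, LinearMap.flip_apply,
    Ext.bilinearCompOfLinear_apply_apply]

lemma exists_of {j : ℕ} (z : LCoh J j M) : ∃ t x, of J j M t x = z :=
  Module.DirectLimit.exists_of z

lemma of_eq_zero {j t : ℕ} (x : Ext.{u} (quotPow J t) M j) (h : of J j M t x = 0) :
    ∃ t', ∃ ht : t ≤ t', (Ext.mk₀ (quotPowMap J ht)).comp x (zero_add j) = 0 :=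
  Module.DirectLimit.of.zero_exact h

lemma post_add {i : ℕ} {J : Ideal R} (ξ η : Ext.{u} M M' i) {j l : ℕ} (h : j + i = l)
    (z : LCoh J j M) : post J (ξ + η) h z = post J ξ h z + post J η h z := by
  obtain ⟨t, x, rfl⟩ := exists_of z
  simp only [post_of, Ext.comp_add, map_add]

lemma post_smul {i : ℕ} (a : R) (ξ : Ext.{u} M M' i) {j l : ℕ} (h : j + i = l) (z : LCoh J j M) :
    post J (a • ξ) h z = a • post J ξ h z := by
  obtain ⟨t, x, rfl⟩ := exists_of z
  simp only [post_of, Ext.comp_smul, map_smul]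

variable (J M M') in
/-- `post` as a linear map in the extension class. -/
def postₗ {i j l : ℕ} (h : j + i = l) : Ext.{u} M M' i →ₗ[R] LCoh J j M →ₗ[R] LCoh J l M' where
  toFun ξ := post J ξ h
  map_add' ξ η := LinearMap.ext (post_add ξ η h)
  map_smul' a ξ := LinearMap.ext (post_smul a ξ h)

lemma post_zero {i j l : ℕ} (h : j + i = l) : post J (0 : Ext.{u} M M' i) h = 0 :=
  map_zero (postₗ J M M' h)

lemma post_comp {i i' i'' : ℕ} (ξ : Ext.{u} M M' i) (η : Ext.{u} M' M'' i') (h : i + i' = i'')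
    {j l l' : ℕ} (hl : j + i = l) (hl' : l + i' = l') (z : LCoh J j M) :
    post J (ξ.comp η h) (by lia : j + i'' = l') z = post J η hl' (post J ξ hl z) := by
  obtain ⟨t, x, rfl⟩ := exists_of z
  simp only [post_of]
  rw [Ext.comp_assoc x ξ η hl h (by lia)]

lemma post_id {j : ℕ} (z : LCoh J j M) : post J (Ext.mk₀ (𝟙 M)) (add_zero j) z = z := by
  obtain ⟨t, x, rfl⟩ := exists_of z
  simp only [post_of, Ext.comp_mk₀_id]

/-- Functoriality of local cohomology. -/
abbrev mapH (J : Ideal R) (f : M ⟶ M') (j : ℕ) : LCoh J j M →ₗ[R] LCoh J j M' :=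
  post J (Ext.mk₀ f) (add_zero j)

variable {S : ShortComplex (ModuleCat.{u} R)}

lemma exact₁ (hS : S.ShortExact) {j l : ℕ} (h : j + 1 = l) (z : LCoh J l S.X₁)
    (hz : mapH J S.f l z = 0) :
    ∃ w : LCoh J j S.X₃, post J hS.extClass h w = z := by
  obtain ⟨t, x, rfl⟩ := exists_of z
  rw [post_of] at hz
  obtain ⟨t', ht, h0⟩ := of_eq_zero _ hz
  rw [← of_trans ht x]
  obtain ⟨y, hy⟩ := Ext.covariant_sequence_exact₁ _ hS
    ((Ext.mk₀ (quotPowMap J ht)).comp x (zero_add l))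
    ((Ext.comp_assoc_of_third_deg_zero _ _ _ _).trans h0) h
  exact ⟨of J j S.X₃ t' y, by rw [post_of, hy]⟩

lemma exact₃ (hS : S.ShortExact) {j l : ℕ} (h : j + 1 = l) (z : LCoh J j S.X₃)
    (hz : post J hS.extClass h z = 0) :
    ∃ w : LCoh J j S.X₂, mapH J S.g j w = z := by
  obtain ⟨t, x, rfl⟩ := exists_of z
  rw [post_of] at hz
  obtain ⟨t', ht, h0⟩ := of_eq_zero _ hz
  rw [← of_trans ht x]
  obtain ⟨y, hy⟩ := Ext.covariant_sequence_exact₃ _ hS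
    ((Ext.mk₀ (quotPowMap J ht)).comp x (zero_add j)) h
    ((Ext.comp_assoc _ _ _ _ _ (by lia)).trans h0)
  exact ⟨of J j S.X₂ t' y, by rw [post_of, hy]⟩

end LCoh

end

section

open CategoryTheory.Abelian (Ext)
variable {R : Type u} [CommRing R]

variable (R) in
/-- The free module on `ι`. -/
abbrev freeMod (ι : Type u) : ModuleCat.{u} R := ModuleCat.of R (ι →₀ R)

variable (R) in
/-- The `i`-th inclusion into a free module. -/
def freeι {ι : Type u} (i : ι) : ModuleCat.of R R ⟶ freeMod R ι :=
  ModuleCat.ofHom (Finsupp.lsingle i)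

variable (R) in
/-- The `i`-th coordinate of a free module. -/
def freeπ {ι : Type u} (i : ι) : freeMod R ι ⟶ ModuleCat.of R R :=
  ModuleCat.ofHom (Finsupp.lapply i)

variable (R) in
/-- The canonical presentation of a module by a free module. -/
abbrev freeCover (M : ModuleCat.{u} R) : ShortComplex (ModuleCat.{u} R) :=
  (Finsupp.linearCombination R (id : M → M)).shortComplexKer

lemma freeCover_shortExact (M : ModuleCat.{u} R) : (freeCover R M).ShortExact :=
  LinearMap.shortExact_shortComplexKer (Finsupp.linearCombination_id_surjective R M)

instance (ι : Type u) : Projective (freeMod R ι) := inferInstance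

lemma ext_freeMod_mem_iSup [IsNoetherianRing R] {ι : Type u} (j : ℕ) :
    ∀ (N : ModuleCat.{u} R) [Module.Finite R N] (e : Ext.{u} N (freeMod R ι) j),
      e ∈ ⨆ i : ι, LinearMap.range
        ((Ext.mk₀ (freeι R i)).postcompOfLinear R N (add_zero j)) := by
  induction j with
  | zero =>
    intro N _ e
    obtain ⟨f, rfl⟩ := (Ext.mk₀_bijective _ _).2 e
    obtain ⟨S, hS⟩ := Module.Finite.fg_top (R := R) (M := N)
    classical
    let s : Finset ι := S.biUnion fun x ↦ (f.hom x).support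
    have hs : ∀ x, f.hom x ∈ Finsupp.supported R R (s : Set ι) := by
      intro x
      have : (⊤ : Submodule R N) ≤ (Finsupp.supported R R (s : Set ι)).comap f.hom := by
        rw [← hS, Submodule.span_le]
        intro y hy
        simp only [Submodule.comap_coe, Set.mem_preimage, SetLike.mem_coe, Finsupp.mem_supported]
        exact_mod_cast Finset.subset_biUnion_of_mem (fun x ↦ (f.hom x).support) hy
      exact this trivial
    have hf : f = ∑ i ∈ s, (f ≫ freeπ R i) ≫ freeι R i := by
      ext x : 2
      rw [ModuleCat.hom_sum, LinearMap.sum_apply]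
      ext i
      simp only [freeπ, freeι, ModuleCat.hom_comp, LinearMap.comp_apply, ModuleCat.hom_ofHom,
        Finsupp.lapply_apply, Finsupp.lsingle_apply, Finsupp.finsetSum_apply,
        Finsupp.single_apply, Finset.sum_ite_eq']
      split_ifs with h
      · rfl
      · exact Finsupp.notMem_support_iff.mp fun h' ↦ h (hs x h')
    have : Ext.mk₀ f = ∑ i ∈ s, (Ext.mk₀ (f ≫ freeπ R i)).comp (Ext.mk₀ (freeι R i))
        (add_zero 0) := by
      simp_rw [Ext.mk₀_comp_mk₀]
      conv_lhs => rw [hf]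
      exact map_sum (Ext.addEquiv₀ (X := N) (Y := freeMod R ι)).symm.toAddMonoidHom _ _
    rw [this]
    exact Submodule.sum_mem _ fun i _ ↦ Submodule.mem_iSup_of_mem i ⟨_, rfl⟩
  | succ j ih =>
    intro N _ e
    obtain ⟨n, f, hf⟩ := Module.Finite.exists_fin' R N
    let f' : (ULift.{u} (Fin n) → R) →ₗ[R] N :=
      f ∘ₗ (LinearEquiv.funCongrLeft R R Equiv.ulift.symm).toLinearMap
    have hf' : Function.Surjective f' := hf.comp (LinearEquiv.surjective _)
    have hS := LinearMap.shortExact_shortComplexKer hf'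
    obtain ⟨e', rfl⟩ := precomp_extClass_surjective_of_projective_X₂ (freeMod R ι) hS j e
    have h1 := Submodule.mem_map_of_mem
      (f := hS.extClass.precompOfLinear R (freeMod R ι) (add_comm 1 j)) (ih _ e')
    rw [Submodule.map_iSup] at h1
    refine SetLike.le_def.mp (iSup_mono fun i ↦ ?_) h1
    rintro _ ⟨_, ⟨x, rfl⟩, rfl⟩
    exact ⟨hS.extClass.comp x (add_comm 1 j), Ext.comp_assoc _ _ _ _ (add_zero j) (by lia)⟩

namespace LCoh

variable {J : Ideal R}

lemma mem_iSup_freeMod [IsNoetherianRing R] {ι : Type u} {j : ℕ} (z : LCoh J j (freeMod R ι)) :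
    z ∈ ⨆ i : ι, LinearMap.range (mapH J (freeι R i) j) := by
  obtain ⟨t, x, rfl⟩ := exists_of z
  have h1 := Submodule.mem_map_of_mem (f := of J j (freeMod R ι) t)
    (ext_freeMod_mem_iSup j (quotPow J t) x)
  rw [Submodule.map_iSup] at h1
  refine SetLike.le_def.mp (iSup_mono fun i ↦ ?_) h1
  rintro _ ⟨_, ⟨x, rfl⟩, rfl⟩
  exact ⟨of J j _ t x, post_of _ _ _ _⟩

lemma mapH_comp {M M' M'' : ModuleCat.{u} R} (f : M ⟶ M') (g : M' ⟶ M'') (j : ℕ)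
    (z : LCoh J j M) : mapH J (f ≫ g) j z = mapH J g j (mapH J f j z) := by
  rw [mapH, ← Ext.mk₀_comp_mk₀ f g]
  exact post_comp _ _ _ _ _ _

lemma freeMod_subsingleton [IsNoetherianRing R] (ι : Type u) {j : ℕ}
    (h : Subsingleton (LCoh J j (ModuleCat.of R R))) :
    Subsingleton (LCoh J j (freeMod R ι)) := by
  refine subsingleton_of_forall_eq 0 fun z ↦ ?_
  have := mem_iSup_freeMod z
  rw [iSup_eq_bot.mpr] at this
  · exact this
  · rintro i
    rw [LinearMap.range_eq_bot]
    exact LinearMap.ext fun z ↦ by rw [Subsingleton.elim z 0, map_zero, map_zero]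

end LCoh

end

section

open CategoryTheory.Abelian (Ext)
variable {R : Type u} [CommRing R]

lemma ext_subsingleton_of_linearEquiv {N N' : ModuleCat.{u} R} (e : N ≃ₗ[R] N')
    (Y : ModuleCat.{u} R) (i : ℕ) (h : Subsingleton (Ext.{u} N' Y i)) :
    Subsingleton (Ext.{u} N Y i) := by
  refine subsingleton_of_forall_eq 0 fun x ↦ ?_
  rw [← Ext.mk₀_id_comp x, ← e.toModuleIso.hom_inv_id, ← Ext.mk₀_comp_mk₀_assoc,
    Subsingleton.elim ((Ext.mk₀ e.toModuleIso.inv).comp x _) 0, Ext.comp_zero]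

lemma ext_smul_id_comp {M Y : ModuleCat.{u} R} (r : R) {i : ℕ} (z : Ext.{u} M Y i) :
    (Ext.mk₀ (r • 𝟙 M)).comp z (zero_add i) = r • z := by
  rw [Ext.mk₀_smul, Ext.smul_comp, Ext.mk₀_id_comp]

/-- Vanishing of `Ext` can be checked on cyclic modules `R ⧸ q` with `q` a prime in the support. -/
lemma ext_subsingleton_of_support [IsNoetherianRing R] (Y : ModuleCat.{u} R) (i : ℕ)
    (N : Type u) [AddCommGroup N] [Module R N] [hN : Module.Finite R N]
    (h : ∀ q ∈ Module.support R N,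
      Subsingleton (Ext.{u} (ModuleCat.of R (R ⧸ q.asIdeal)) Y i)) :
    Subsingleton (Ext.{u} (ModuleCat.of R N) Y i) := by
  revert h
  induction hN using IsNoetherianRing.induction_on_isQuotientEquivQuotientPrime R with
  | subsingleton N =>
    intro _
    refine subsingleton_of_forall_eq 0 fun x ↦ ?_
    rw [← Ext.mk₀_id_comp x, (IsZero.iff_id_eq_zero _).mp
      (ModuleCat.isZero_of_subsingleton (ModuleCat.of R N)), Ext.mk₀_zero, Ext.zero_comp]
  | quotient N p f =>
    intro h
    refine ext_subsingleton_of_linearEquiv (N := ModuleCat.of R N) f Y i (h p ?_)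
    rw [f.support_eq, Module.support_eq_zeroLocus, Ideal.annihilator_quotient]
    exact fun _ hx ↦ hx
  | exact N₁ N₂ N₃ f g hf hg hfg h₁ h₃ =>
    intro h
    rw [Module.support_of_exact hfg hf hg] at h
    have h₁ := h₁ fun q hq ↦ h q (Or.inl hq)
    have h₃ := h₃ fun q hq ↦ h q (Or.inr hq)
    let S := ModuleCat.shortComplexOfCompEqZero f g hfg.linearMap_comp_eq_zero
    have hS : S.ShortExact := ModuleCat.shortComplex_shortExact S hfg hf hg
    refine subsingleton_of_forall_eq 0 fun x ↦ ?_
    obtain ⟨y, rfl⟩ := Ext.contravariant_sequence_exact₂ hS Y x (Subsingleton.elim (h := h₁) _ _)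
    rw [Subsingleton.elim (h := h₃) y 0, Ext.comp_zero]

/-- The hypothesis `Ext^i(k, R) = 0` for `i < n` propagates to `Ext^i(R ⧸ p, R) = 0` for
`i + coheight p < n`. -/
lemma ext_quotient_prime_subsingleton [IsNoetherianRing R] [IsLocalRing R]
    (Y : ModuleCat.{u} R) [Module.Finite R Y] (n : ℕ)
    (hY : ∀ i < n, Subsingleton (Ext.{u} (ModuleCat.of R (R ⧸ maximalIdeal R)) Y i)) (k : ℕ) :
    ∀ (i : ℕ) (p : PrimeSpectrum R), Order.coheight p ≤ k → i + k < n →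
      Subsingleton (Ext.{u} (ModuleCat.of R (R ⧸ p.asIdeal)) Y i) := by
  induction k with
  | zero =>
    intro i p hp hi
    have hmax : p = closedPoint R := by
      by_contra hne
      have hlt : p < closedPoint R :=
        lt_of_le_of_ne (IsLocalRing.le_maximalIdeal p.2.ne_top) hne
      have := (Order.coheight_add_one_le hlt).trans hp
      simp at this
    subst hmax
    exact hY i (by lia)
  | succ k ih =>
    intro i p hp hi
    by_cases hmax : p = closedPoint R
    · subst hmax
      exact hY i (by lia)
    have hlt : p < closedPoint R := lt_of_le_of_ne (IsLocalRing.le_maximalIdeal p.2.ne_top) hmax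
    obtain ⟨x, hxm, hxp⟩ := SetLike.exists_of_lt (show p.asIdeal < maximalIdeal R from hlt)
    have hreg : IsSMulRegular (R ⧸ p.asIdeal) x := by
      rw [isSMulRegular_iff_right_eq_zero_of_smul]
      intro y hy
      obtain ⟨y, rfl⟩ := Ideal.Quotient.mk_surjective y
      rw [← Ideal.Quotient.mk_eq_mk, ← Submodule.Quotient.mk_smul, Ideal.Quotient.mk_eq_mk,
        Ideal.Quotient.eq_zero_iff_mem] at hy
      exact Ideal.Quotient.eq_zero_iff_mem.mpr ((p.2.mem_or_mem hy).resolve_left hxp)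
    have hS := hreg.smulShortComplex_shortExact (M := ModuleCat.of R (R ⧸ p.asIdeal))
    have h3 : Subsingleton
        (Ext.{u} (ModuleCat.of R (QuotSMulTop x (R ⧸ p.asIdeal))) Y (i + 1)) := by
      refine ext_subsingleton_of_support Y (i + 1) _ fun q hq ↦ ih (i + 1) q ?_ (by lia)
      rw [Module.support_quotSMulTop, Module.support_eq_zeroLocus,
        Ideal.annihilator_quotient] at hq
      have hpq : p < q := by
        refine lt_of_le_of_ne hq.1 ?_
        rintro rfl
        exact hxp (hq.2 rfl)
      have := (Order.coheight_add_one_le hpq).trans hp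
      rw [Nat.cast_add, Nat.cast_one] at this
      exact (ENat.add_le_add_iff_right (by simp)).mp this
    suffices htop : (⊤ : Submodule R (Ext.{u} (ModuleCat.of R (R ⧸ p.asIdeal)) Y i)) = ⊥ from
      subsingleton_of_forall_eq 0 fun x ↦ (Submodule.mem_bot R).mp (htop ▸ Submodule.mem_top)
    refine Submodule.eq_bot_of_le_smul_of_le_jacobson_bot (maximalIdeal R) _
      (Module.Finite.fg_top) ?_ (maximalIdeal_le_jacobson _)
    intro y _
    obtain ⟨z, hz⟩ := Ext.contravariant_sequence_exact₁ hS Y y (add_comm 1 i)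
      (Subsingleton.elim (h := h3) _ _)
    have : y = x • z := by
      rw [← hz]
      exact ext_smul_id_comp x z
    rw [this]
    exact Submodule.smul_mem_smul hxm trivial

/-- A weakly regular sequence contained in a prime of the support forces the height to be
at least its length. -/
lemma length_le_height_of_isWeaklyRegular [IsNoetherianRing R] (rs : List R) :
    ∀ (M : Type u) [AddCommGroup M] [Module R M] [Module.Finite R M] (p : PrimeSpectrum R),
      p ∈ Module.support R M → (∀ r ∈ rs, r ∈ p.asIdeal) →
      RingTheory.Sequence.IsWeaklyRegular M rs →
      ∃ q ∈ Module.support R M, q ≤ p ∧ Order.height q + rs.length ≤ Order.height p := by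
  induction rs with
  | nil => exact fun M _ _ _ p hp _ _ ↦ ⟨p, hp, le_rfl, by simp⟩
  | cons x rs ih =>
    intro M _ _ _ p hp hmem hreg
    rw [RingTheory.Sequence.isWeaklyRegular_cons_iff] at hreg
    simp only [List.mem_cons, forall_eq_or_imp] at hmem
    obtain ⟨q', hq', hle, hht⟩ := ih (QuotSMulTop x M) p
      (by rw [Module.support_quotSMulTop]; exact ⟨hp, by simpa using hmem.1⟩) hmem.2 hreg.2
    rw [Module.support_quotSMulTop] at hq'
    obtain ⟨q, hq, hqle⟩ := Ideal.exists_minimalPrimes_le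
      (Module.annihilator_le_of_mem_support hq'.1)
    have hxq := hreg.1.notMem_of_mem_minimalPrimes hq
    let Q : PrimeSpectrum R := ⟨q, hq.1.1⟩
    have hlt : Q < q' := by
      refine lt_of_le_of_ne hqle ?_
      rintro rfl
      exact hxq (hq'.2 rfl)
    refine ⟨Q, Module.mem_support_iff_of_finite.mpr hq.1.2, hlt.le.trans hle, ?_⟩
    rw [List.length_cons, Nat.cast_add, Nat.cast_one, add_comm (rs.length : ℕ∞), ← add_assoc]
    exact (add_le_add_left (Order.height_add_one_le hlt) _).trans hht

end

section

open CategoryTheory.Abelian (Ext)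
variable {R : Type u} [CommRing R]

variable (R) in
/-- The Gorenstein condition in terms of `CategoryTheory.Abelian.Ext`. -/
structure IsGorensteinOfDim [IsLocalRing R] (n : ℕ) : Prop where
  dim : ringKrullDim R = n
  ext_eq_zero (i : ℕ) (hi : i ≠ n) :
    Subsingleton (Ext.{u} (ModuleCat.of R (R ⧸ maximalIdeal R)) (ModuleCat.of R R) i)
  ext_equiv :
    Nonempty (Ext.{u} (ModuleCat.of R (R ⧸ maximalIdeal R)) (ModuleCat.of R R) n ≃ₗ[R]
      (R ⧸ maximalIdeal R))

/-- Rees' theorem for cyclic modules. -/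
lemma exists_isRegular_of_ext_quotient [IsNoetherianRing R] (J : Ideal R) (hJ : J ≠ ⊤) (r : ℕ)
    (h : ∀ i < r, Subsingleton (Ext.{u} (ModuleCat.of R (R ⧸ J)) (ModuleCat.of R R) i)) :
    ∃ rs : List R, rs.length = r ∧ (∀ x ∈ rs, x ∈ J) ∧ RingTheory.Sequence.IsRegular R rs := by
  refine ModuleCat.exists_isRegular_of_exists_subsingleton_ext J r (ModuleCat.of R R) ?_
    (ModuleCat.of R (R ⧸ J)) ?_ h
  · rw [lt_top_iff_ne_top]
    intro h
    exact hJ (by simpa using h)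
  · rw [Module.support_eq_zeroLocus, Ideal.annihilator_quotient]

lemma hasProjectiveDimensionLT_quotient [IsNoetherianRing R] [IsLocalRing R] {rs : List R}
    (h : RingTheory.Sequence.IsRegular R rs) :
    HasProjectiveDimensionLT (ModuleCat.of R (R ⧸ Ideal.ofList rs)) (rs.length + 1) := by
  have := ModuleCat.projectiveDimension_quotient_eq_length.{u} rs h
  rw [projectiveDimension_eq_of_iso (Shrink.linearEquiv R _).toModuleIso] at this
  exact (projectiveDimension_le_iff _ _).mp this.le

namespace IsGorensteinOfDim
variable [IsNoetherianRing R] [IsLocalRing R] {n : ℕ}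

lemma ext_subsingleton (hR : IsGorensteinOfDim R n) (N : Type u) [AddCommGroup N]
    [Module R N] [Module.Finite R N] (t : ℕ) (hN : maximalIdeal R ^ t ≤ Module.annihilator R N) (i : ℕ)
    (hi : i ≠ n) :
    Subsingleton (Ext.{u} (ModuleCat.of R N) (ModuleCat.of R R) i) := by
  refine ext_subsingleton_of_support _ _ _ fun q hq ↦ ?_
  have : q = closedPoint R := by
    refine le_antisymm (IsLocalRing.le_maximalIdeal q.2.ne_top) ?_
    exact q.2.le_of_pow_le (hN.trans (Module.annihilator_le_of_mem_support hq))
  subst this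
  exact hR.ext_eq_zero i hi

lemma ext_quotPow_subsingleton (hR : IsGorensteinOfDim R n) (t i : ℕ) (hi : i ≠ n) :
    Subsingleton (Ext.{u} (quotPow (maximalIdeal R) t) (ModuleCat.of R R) i) :=
  hR.ext_subsingleton _ t (by rw [Ideal.annihilator_quotient]) i hi

lemma height_add_coheight (hR : IsGorensteinOfDim R n) (p : PrimeSpectrum R) :
    Order.height p + Order.coheight p = n := by
  refine le_antisymm ?_ ?_
  · have h := hR.dim
    rw [ringKrullDim, Order.krullDim_eq_iSup_height_add_coheight_of_nonempty] at h
    have h : (⨆ a : PrimeSpectrum R, Order.height a + Order.coheight a) = (n : ℕ∞) := by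
      exact_mod_cast h
    exact h ▸ le_iSup (fun a : PrimeSpectrum R ↦ Order.height a + Order.coheight a) p
  · have hfin : Order.coheight p ≠ ⊤ := by
      have h := (Order.coheight_le_krullDim p).trans_eq hR.dim
      exact ne_top_of_le_ne_top (ENat.natCast_ne_top n) (by exact_mod_cast h)
    obtain ⟨k, hk⟩ := ENat.ne_top_iff_exists.mp hfin
    obtain ⟨rs, hlen, hmem, hreg⟩ := exists_isRegular_of_ext_quotient p.asIdeal p.2.ne_top (n - k)
      fun i hi ↦ ext_quotient_prime_subsingleton (ModuleCat.of R R) n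
        (fun i hi ↦ hR.ext_eq_zero i hi.ne) k i p hk.ge (by lia)
    obtain ⟨q, -, -, hq⟩ := length_le_height_of_isWeaklyRegular rs R p
      (by simp [Module.support_eq_zeroLocus, Module.annihilator_eq_bot.mpr inferInstance])
      hmem hreg.1
    rw [hlen] at hq
    rw [← hk]
    calc (n : ℕ∞) ≤ ((n - k : ℕ) : ℕ∞) + k := by norm_cast; lia
      _ ≤ _ := by gcongr; exact le_add_self.trans hq

lemma idealHeight_add (hR : IsGorensteinOfDim R n) (I : Ideal R) (c d : ℕ)
    (hc : idealHeight R I = c) (hd : ringKrullDim (R ⧸ I) = d) : c + d = n := by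
  have hI : I ≠ ⊤ := by
    rintro rfl
    have : Subsingleton (R ⧸ (⊤ : Ideal R)) := Ideal.Quotient.subsingleton_iff.mpr rfl
    rw [ringKrullDim_eq_bot_of_subsingleton] at hd
    exact (WithBot.coe_ne_bot hd.symm).elim
  have hIm := IsLocalRing.le_maximalIdeal hI
  have : Nonempty {p : PrimeSpectrum R // I ≤ p.asIdeal} := ⟨⟨closedPoint R, hIm⟩⟩
  rw [ringKrullDim_quotient] at hd
  obtain ⟨⟨p, hp⟩, hpc⟩ := ENat.exists_eq_iInf
    fun p : {p : PrimeSpectrum R // I ≤ p.asIdeal} ↦ Order.height (p : PrimeSpectrum R)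
  rw [← idealHeight, hc] at hpc
  change Order.height p = c at hpc
  have hp_add := hR.height_add_coheight p
  have h1 : Order.coheight p ≤ d := by
    have h := Order.krullDim_le_of_strictMono
      (fun q : Set.Ici p ↦ (⟨q, hp.trans q.2⟩ : PrimeSpectrum.zeroLocus (R := R) I))
      fun a b h ↦ h
    rw [hd, ← Order.coheight_eq_krullDim_Ici] at h
    exact_mod_cast h
  have : Nonempty (PrimeSpectrum.zeroLocus (R := R) I) := ⟨⟨closedPoint R, hIm⟩⟩
  have h2 : (c : ℕ∞) + d ≤ n := by
    rw [Order.krullDim_eq_iSup_coheight_of_nonempty] at hd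
    have hd' : (⨆ a : PrimeSpectrum.zeroLocus (R := R) I, Order.coheight a) = (d : ℕ∞) := by
      exact_mod_cast hd
    rw [← hd', ENat.add_iSup]
    refine iSup_le fun q ↦ ?_
    rw [← hR.height_add_coheight q, ← hc]
    refine add_le_add (iInf_le (fun p : {p : PrimeSpectrum R // I ≤ p.asIdeal} ↦
      Order.height (p : PrimeSpectrum R)) ⟨q, q.2⟩) ?_
    exact Order.coheight_le_coheight_apply_of_strictMono
      (Subtype.val : PrimeSpectrum.zeroLocus (R := R) I → PrimeSpectrum R) (fun a b h ↦ h) q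
  rw [hpc] at hp_add
  have h3 : (n : ℕ∞) ≤ c + d := by
    rw [← hp_add]
    gcongr
  exact_mod_cast le_antisymm h2 h3

lemma LCoh_subsingleton_succ (hR : IsGorensteinOfDim R n) (K : ModuleCat.{u} R) :
    Subsingleton (LCoh (maximalIdeal R) (n + 1) K) := by
  refine subsingleton_of_forall_eq 0 fun z ↦ ?_
  obtain ⟨t, x, rfl⟩ := LCoh.exists_of z
  obtain ⟨rs, hlen, hmem, hreg⟩ := exists_isRegular_of_ext_quotient (maximalIdeal R ^ (t + 1))
    ((Ideal.pow_le_self (by simp)).trans_lt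
      (lt_top_iff_ne_top.mpr (maximalIdeal.isMaximal R).ne_top)).ne n
    fun i hi ↦ hR.ext_quotPow_subsingleton (t + 1) i hi.ne
  have hle : Ideal.ofList rs ≤ maximalIdeal R ^ (t + 1) := Ideal.span_le.mpr fun x hx ↦ hmem x hx
  obtain ⟨s, hs⟩ : ∃ s, maximalIdeal R ^ s ≤ Ideal.ofList rs := by
    refine Ideal.exists_pow_le_of_le_radical_of_fg ?_ (IsNoetherian.noetherian _)
    rw [Ideal.radical_eq_sInf]
    refine le_sInf fun p ⟨hp, hprime⟩ ↦ ?_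
    let P : PrimeSpectrum R := ⟨p, hprime⟩
    obtain ⟨q, -, -, hq⟩ := length_le_height_of_isWeaklyRegular rs R P
      (by simp [Module.support_eq_zeroLocus, Module.annihilator_eq_bot.mpr inferInstance])
      (fun x hx ↦ hp (Ideal.subset_span hx)) hreg.1
    have hadd := hR.height_add_coheight P
    have hco : Order.coheight P = 0 := by
      rw [hlen] at hq
      have h1 : (n : ℕ∞) + Order.coheight P ≤ n + 0 := by
        rw [add_zero, ← hadd]
        gcongr
        rw [hadd]
        exact le_add_self.trans hq
      exact nonpos_iff_eq_zero.mp ((ENat.add_le_add_iff_left (ENat.natCast_ne_top n)).mp h1)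
    have hmax : IsMax P := Order.coheight_eq_zero.mp hco
    exact hmax (b := closedPoint R) (IsLocalRing.le_maximalIdeal hprime.ne_top)
  have : HasProjectiveDimensionLT (ModuleCat.of R (R ⧸ Ideal.ofList rs)) (n + 1) :=
    hlen ▸ hasProjectiveDimensionLT_quotient hreg
  let a : quotPow (maximalIdeal R) (s + t) ⟶ ModuleCat.of R (R ⧸ Ideal.ofList rs) :=
    ModuleCat.ofHom (Submodule.mapQ _ _ LinearMap.id
      ((Ideal.pow_le_pow_right (Nat.le_add_right s t)).trans hs))
  let b : ModuleCat.of R (R ⧸ Ideal.ofList rs) ⟶ quotPow (maximalIdeal R) t :=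
    ModuleCat.ofHom (Submodule.mapQ _ _ LinearMap.id
      (hle.trans (Ideal.pow_le_pow_right (Nat.le_succ t))))
  have hab : quotPowMap (maximalIdeal R) (Nat.le_add_left t s) = a ≫ b := by
    ext
    rfl
  rw [← LCoh.of_trans (Nat.le_add_left t s) x, hab, ← Ext.mk₀_comp_mk₀_assoc,
    Ext.eq_zero_of_hasProjectiveDimensionLT ((Ext.mk₀ b).comp x _) (n + 1) le_rfl,
    Ext.comp_zero, map_zero]

lemma LCoh_freeMod_subsingleton (hR : IsGorensteinOfDim R n) (ι : Type u) (j : ℕ) (hj : j ≠ n) :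
    Subsingleton (LCoh (maximalIdeal R) j (freeMod R ι)) := by
  refine LCoh.freeMod_subsingleton ι (subsingleton_of_forall_eq 0 fun z ↦ ?_)
  obtain ⟨t, x, rfl⟩ := LCoh.exists_of z
  have := hR.ext_quotPow_subsingleton t j hj
  rw [Subsingleton.elim x 0, map_zero]

end IsGorensteinOfDim

end

section

open CategoryTheory.Abelian (Ext)
variable {R : Type u} [CommRing R]

/-- The morphism `R ⧸ J ^ t → N` sending `1` to `x`, for `N` killed by `J ^ t`. -/
def quotPowHom {J : Ideal R} {t : ℕ} {N : ModuleCat.{u} R} (hN : J ^ t ≤ Module.annihilator R N)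
    (x : N) : quotPow J t ⟶ N :=
  ModuleCat.ofHom (Submodule.liftQ _ (LinearMap.toSpanSingleton R N x)
    fun _ hr ↦ Module.mem_annihilator.mp (hN hr) x)

lemma quotPowHom_one {J : Ideal R} {t : ℕ} {N : ModuleCat.{u} R}
    (hN : J ^ t ≤ Module.annihilator R N) (x : N) : quotPowHom hN x (1 : R ⧸ J ^ t) = x :=
  one_smul R x

lemma quotPow_hom_ext {J : Ideal R} {t : ℕ} {N : ModuleCat.{u} R} {v w : quotPow J t ⟶ N}
    (h : v (1 : R ⧸ J ^ t) = w (1 : R ⧸ J ^ t)) : v = w := by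
  ext
  exact h

lemma quotPow_end {J : Ideal R} {t : ℕ} {r : R} {v : quotPow J t ⟶ quotPow J t}
    (h : v (1 : R ⧸ J ^ t) = Ideal.Quotient.mk (J ^ t) r) : v = r • 𝟙 _ := by
  apply quotPow_hom_ext
  rw [h]
  change _ = r • (1 : R ⧸ J ^ t)
  rw [Algebra.smul_def, mul_one]
  rfl

lemma smul_ext_quotPow_eq_zero {J : Ideal R} {t i : ℕ} {Y : ModuleCat.{u} R}
    (x : Ext.{u} (quotPow J t) Y i) (r : R) (hr : r ∈ J ^ t) : r • x = 0 := by
  have : r • 𝟙 (quotPow J t) = 0 := by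
    apply quotPow_hom_ext
    change r • (1 : R ⧸ J ^ t) = 0
    rw [Algebra.smul_def, mul_one]
    exact Ideal.Quotient.eq_zero_iff_mem.mpr hr
  rw [← ext_smul_id_comp, this, Ext.mk₀_zero, Ext.zero_comp]

lemma annihilator_quotPow (J : Ideal R) (t : ℕ) : J ^ t ≤ Module.annihilator R (quotPow J t) := by
  rw [Ideal.annihilator_quotient]

/-- An extension class on a finite power decomposes along the factors. -/
lemma eq_sum_of_pi {Y : ModuleCat.{u} R} {r : ℕ} {A : Type u} [AddCommGroup A] [Module R A] {i : ℕ}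
    (ξ : Ext.{u} (ModuleCat.of R (Fin r → A)) Y i) :
    ξ = ∑ a : Fin r, (Ext.mk₀ (ModuleCat.ofHom (LinearMap.proj a : (Fin r → A) →ₗ[R] A))).comp
      ((Ext.mk₀ (ModuleCat.ofHom (LinearMap.single R (fun _ : Fin r ↦ A) a))).comp ξ
        (zero_add i)) (zero_add i) := by
  have : 𝟙 (ModuleCat.of R (Fin r → A)) =
      ∑ a : Fin r, ModuleCat.ofHom (LinearMap.proj a : (Fin r → A) →ₗ[R] A) ≫
        ModuleCat.ofHom (LinearMap.single R (fun _ : Fin r ↦ A) a) := by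
    ext v b
    simp [ModuleCat.hom_sum]
  simp_rw [Ext.mk₀_comp_mk₀_assoc]
  rw [← Ext.sum_comp, ← Ext.mk₀_sum, ← this, Ext.mk₀_id_comp]

lemma exists_presentation {N : ModuleCat.{u} R} [Module.Finite R N] {J : Ideal R} {t : ℕ}
    (hN : J ^ t ≤ Module.annihilator R N) :
    ∃ (r : ℕ) (p : ModuleCat.of R (Fin r → R ⧸ J ^ t) ⟶ N), Function.Surjective p := by
  obtain ⟨r, f, hf⟩ := Module.Finite.exists_fin' R N
  refine ⟨r, ModuleCat.ofHom (∑ a : Fin r, (quotPowHom hN (f (Pi.single a 1))).hom ∘ₗ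
    LinearMap.proj a), fun x ↦ ?_⟩
  obtain ⟨v, rfl⟩ := hf x
  refine ⟨fun a ↦ Ideal.Quotient.mk _ (v a), ?_⟩
  refine (LinearMap.sum_apply _ _ _).trans ?_
  rw [LinearMap.pi_apply_eq_sum_univ f v]
  refine Finset.sum_congr rfl fun a _ ↦ ?_
  change v a • f _ = v a • f _
  congr 2
  ext b
  simp [Pi.single_apply, eq_comm]

lemma annihilator_pi (J : Ideal R) (r t : ℕ) : J ^ t ≤
    Module.annihilator R (ModuleCat.of R (Fin r → R ⧸ J ^ t)) := fun _ hx ↦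
  Module.mem_annihilator.mpr fun v ↦ funext fun a ↦
    Module.mem_annihilator.mp (annihilator_quotPow _ t hx) (v a)

namespace IsGorensteinOfDim
variable [IsNoetherianRing R] [IsLocalRing R] {n : ℕ}

lemma precomp_injective (hR : IsGorensteinOfDim R n) {N N' : ModuleCat.{u} R} [Module.Finite R N]
    {t : ℕ} (hN : maximalIdeal R ^ t ≤ Module.annihilator R N) (g : N ⟶ N')
    (hg : Function.Surjective g) (x : Ext.{u} N' (ModuleCat.of R R) n)
    (hx : (Ext.mk₀ g).comp x (zero_add n) = 0) : x = 0 := by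
  obtain _ | l := n
  · obtain ⟨x, rfl⟩ := (Ext.mk₀_bijective _ _).2 x
    rw [Ext.mk₀_comp_mk₀, Ext.mk₀_eq_zero_iff] at hx
    have : Epi g := (ModuleCat.epi_iff_surjective g).mpr hg
    rw [(cancel_epi g).mp (hx.trans comp_zero.symm), Ext.mk₀_zero]
  · have hS := LinearMap.shortExact_shortComplexKer (f := g.hom) hg
    obtain ⟨y, hy⟩ := Ext.contravariant_sequence_exact₃ hS _ x hx (add_comm 1 l)
    have : Subsingleton (Ext.{u} g.hom.shortComplexKer.X₁ (ModuleCat.of R R) l) :=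
      hR.ext_subsingleton (LinearMap.ker g.hom) t
        (hN.trans (LinearMap.annihilator_le_of_injective _ (LinearMap.ker g.hom).subtype_injective))
        l (by lia)
    rw [← hy, Subsingleton.elim y 0, Ext.comp_zero]

lemma precomp_surjective (hR : IsGorensteinOfDim R n) {N N' : ModuleCat.{u} R} [Module.Finite R N]
    {t : ℕ} (hN : maximalIdeal R ^ t ≤ Module.annihilator R N) (f : N' ⟶ N)
    (hf : Function.Injective f) (x : Ext.{u} N' (ModuleCat.of R R) n) :
    ∃ y : Ext.{u} N (ModuleCat.of R R) n, (Ext.mk₀ f).comp y (zero_add n) = x := by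
  let S := ModuleCat.shortComplexOfCompEqZero f.hom (LinearMap.range f.hom).mkQ
    (LinearMap.range_mkQ_comp _)
  have hS : S.ShortExact := ModuleCat.shortComplex_shortExact S
    (LinearMap.exact_iff.mpr (Submodule.ker_mkQ _)) hf (Submodule.mkQ_surjective _)
  have : Subsingleton (Ext.{u} S.X₃ (ModuleCat.of R R) (n + 1)) :=
    hR.ext_subsingleton (N ⧸ LinearMap.range f.hom) t
      (hN.trans (LinearMap.annihilator_le_of_surjective _ (Submodule.mkQ_surjective _)))
      (n + 1) (by lia)
  exact Ext.contravariant_sequence_exact₁ hS _ x (add_comm 1 n) (Subsingleton.elim _ _)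

lemma of_injective (hR : IsGorensteinOfDim R n) (t : ℕ) :
    Function.Injective (LCoh.of (maximalIdeal R) n (ModuleCat.of R R) t) := by
  rw [injective_iff_map_eq_zero]
  intro x hx
  obtain ⟨t', ht, h⟩ := LCoh.of_eq_zero x hx
  refine hR.precomp_injective (annihilator_quotPow _ t') (quotPowMap _ ht) (fun y ↦ ?_) x h
  obtain ⟨y, rfl⟩ := Ideal.Quotient.mk_surjective y
  exact ⟨Ideal.Quotient.mk _ y, rfl⟩

/-- Classes in `Ext^n(N, R)` are detected on maps `R ⧸ 𝔪 ^ t → N`. -/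
lemma ext_eq_zero_of_forall (hR : IsGorensteinOfDim R n) {N : ModuleCat.{u} R} [Module.Finite R N]
    {t : ℕ} (hN : maximalIdeal R ^ t ≤ Module.annihilator R N)
    (ξ : Ext.{u} N (ModuleCat.of R R) n)
    (h : ∀ v : quotPow (maximalIdeal R) t ⟶ N, (Ext.mk₀ v).comp ξ (zero_add n) = 0) : ξ = 0 := by
  obtain ⟨r, p, hp⟩ := exists_presentation hN
  refine hR.precomp_injective (annihilator_pi _ r t) p hp ξ ?_
  rw [eq_sum_of_pi ((Ext.mk₀ p).comp ξ (zero_add n))]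
  refine Finset.sum_eq_zero fun a _ ↦ ?_
  rw [Ext.mk₀_comp_mk₀_assoc (ModuleCat.ofHom (LinearMap.single R _ a)) p ξ]
  exact (congrArg (fun y ↦ (Ext.mk₀ _).comp y (zero_add n)) (h _)).trans
    (Ext.comp_zero _ _ _ _ _)

/-- A class killed by `q` comes from `R ⧸ q`. -/
lemma exists_of_smul_eq_zero (hR : IsGorensteinOfDim R n) {t : ℕ} {q : Ideal R}
    (hq : maximalIdeal R ^ t ≤ q)
    (x : Ext.{u} (quotPow (maximalIdeal R) t) (ModuleCat.of R R) n)
    (hx : ∀ r ∈ q, r • x = 0) :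
    ∃ y : Ext.{u} (ModuleCat.of R (R ⧸ q)) (ModuleCat.of R R) n,
      (Ext.mk₀ (ModuleCat.ofHom (Submodule.mapQ _ _ LinearMap.id hq) :
        quotPow (maximalIdeal R) t ⟶ ModuleCat.of R (R ⧸ q))).comp y (zero_add n) = x := by
  let g : (R ⧸ maximalIdeal R ^ t) →ₗ[R] R ⧸ q := Submodule.mapQ _ _ LinearMap.id hq
  have hg : Function.Surjective g := fun y ↦ by
    obtain ⟨y, rfl⟩ := Ideal.Quotient.mk_surjective y
    exact ⟨Ideal.Quotient.mk _ y, rfl⟩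
  have hS := LinearMap.shortExact_shortComplexKer hg
  refine Ext.contravariant_sequence_exact₂ hS _ x ?_
  have hK : maximalIdeal R ^ t ≤ Module.annihilator R (LinearMap.ker g) :=
    (annihilator_quotPow _ t).trans
      (LinearMap.annihilator_le_of_injective _ (LinearMap.ker g).subtype_injective)
  refine hR.ext_eq_zero_of_forall (N := ModuleCat.of R (LinearMap.ker g)) hK _ fun v ↦ ?_
  obtain ⟨r, hr⟩ := Ideal.Quotient.mk_surjective
    ((LinearMap.ker g).subtype (v (1 : R ⧸ maximalIdeal R ^ t)))
  have hrq : r ∈ q := by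
    have : g ((LinearMap.ker g).subtype (v (1 : R ⧸ maximalIdeal R ^ t))) = 0 :=
      (v (1 : R ⧸ maximalIdeal R ^ t)).2
    rw [← hr] at this
    exact Ideal.Quotient.eq_zero_iff_mem.mp this
  have hv : v ≫ ModuleCat.ofHom (LinearMap.ker g).subtype = r • 𝟙 _ := quotPow_end hr.symm
  refine (Ext.mk₀_comp_mk₀_assoc _ _ _).trans ?_
  refine (congrArg (fun w ↦ (Ext.mk₀ w).comp x (zero_add n)) hv).trans ?_
  rw [ext_smul_id_comp, hx r hrq]

end IsGorensteinOfDim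

end

section

open CategoryTheory.Abelian (Ext)
variable {R : Type u} [CommRing R]

variable (R) in
/-- `E` is an injective hull of the residue field of a local ring. -/
structure IsResidueHull [IsLocalRing R] (E : Type u) [AddCommGroup E] [Module R E] : Prop where
  injective : Module.Injective R E
  torsion (e : E) : ∃ t, ∀ r ∈ maximalIdeal R ^ t, r • e = 0
  socle : ∃ e₀ : E, e₀ ≠ 0 ∧ (∀ r ∈ maximalIdeal R, r • e₀ = 0) ∧
    ∀ e : E, (∀ r ∈ maximalIdeal R, r • e = 0) → ∃ a : R, e = a • e₀

lemma LCoh.torsion {J : Ideal R} {j : ℕ} {M : ModuleCat.{u} R} (e : LCoh J j M) :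
    ∃ t, ∀ r ∈ J ^ t, r • e = 0 := by
  obtain ⟨t, x, rfl⟩ := LCoh.exists_of e
  exact ⟨t, fun r hr ↦ by rw [← map_smul, smul_ext_quotPow_eq_zero x r hr, map_zero]⟩

lemma LCoh.torsion_of_fg {J : Ideal R} {j : ℕ} {M : ModuleCat.{u} R}
    (P : Submodule R (LCoh J j M)) (hP : P.FG) :
    ∃ t, ∀ r ∈ J ^ t, ∀ e ∈ P, r • e = 0 := by
  induction P, hP using Submodule.fg_induction with
  | singleton e =>
    obtain ⟨t, ht⟩ := torsion e
    refine ⟨t, fun r hr y hy ↦ ?_⟩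
    obtain ⟨a, rfl⟩ := Submodule.mem_span_singleton.mp hy
    rw [smul_comm, ht r hr, smul_zero]
  | sup P Q _ _ hP hQ =>
    obtain ⟨t, ht⟩ := hP
    obtain ⟨t', ht'⟩ := hQ
    refine ⟨t + t', fun r hr y hy ↦ ?_⟩
    obtain ⟨a, ha, b, hb, rfl⟩ := Submodule.mem_sup.mp hy
    rw [smul_add, ht r (Ideal.pow_le_pow_right (Nat.le_add_right t t') hr) a ha,
      ht' r (Ideal.pow_le_pow_right (Nat.le_add_left t' t) hr) b hb, add_zero]

namespace IsGorensteinOfDim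
variable [IsNoetherianRing R] [IsLocalRing R] {n : ℕ}

lemma exists_of_eq (hR : IsGorensteinOfDim R n) (t : ℕ)
    (e : LCoh (maximalIdeal R) n (ModuleCat.of R R))
    (he : ∀ r ∈ maximalIdeal R ^ t, r • e = 0) :
    ∃ x, LCoh.of (maximalIdeal R) n (ModuleCat.of R R) t x = e := by
  obtain ⟨t', x, rfl⟩ := LCoh.exists_of e
  rw [← LCoh.of_trans (Nat.le_add_left t' t) x] at he ⊢
  generalize (Ext.mk₀ (quotPowMap (maximalIdeal R) (Nat.le_add_left t' t))).comp x _ = x at he ⊢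
  have ht := Nat.le_add_right t t'
  obtain ⟨y, hy⟩ := hR.exists_of_smul_eq_zero (Ideal.pow_le_pow_right ht) x
    fun r hr ↦ hR.of_injective _ (by rw [map_smul, he r hr, map_zero])
  refine ⟨y, ?_⟩
  rw [← hy, ← LCoh.of_trans ht y]
  rfl

/-- Linear maps `N → H^n_𝔪(R)` come from classes in `Ext^n(N, R)`. -/
lemma exists_ext_of_linearMap (hR : IsGorensteinOfDim R n) {N : ModuleCat.{u} R}
    [Module.Finite R N] {t : ℕ} (hN : maximalIdeal R ^ t ≤ Module.annihilator R N)
    (f : N →ₗ[R] LCoh (maximalIdeal R) n (ModuleCat.of R R)) :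
    ∃ ξ : Ext.{u} N (ModuleCat.of R R) n, ∀ v : quotPow (maximalIdeal R) t ⟶ N,
      LCoh.of (maximalIdeal R) n (ModuleCat.of R R) t ((Ext.mk₀ v).comp ξ (zero_add n)) =
        f (v (1 : R ⧸ maximalIdeal R ^ t)) := by
  obtain ⟨r, p, hp⟩ := exists_presentation hN
  let A := R ⧸ maximalIdeal R ^ t
  have hx (a : Fin r) : ∃ x, LCoh.of (maximalIdeal R) n (ModuleCat.of R R) t x =
      f (p (Pi.single a (1 : A))) := by
    refine hR.exists_of_eq t _ fun s hs ↦ ?_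
    rw [← map_smul, Module.mem_annihilator.mp (hN hs), map_zero]
  choose x hx using hx
  let η : Ext.{u} (ModuleCat.of R (Fin r → A)) (ModuleCat.of R R) n :=
    ∑ a : Fin r, (Ext.mk₀ (ModuleCat.ofHom (LinearMap.proj a : (Fin r → A) →ₗ[R] A))).comp
      (x a) (zero_add n)
  have hη (w : quotPow (maximalIdeal R) t ⟶ ModuleCat.of R (Fin r → A)) :
      LCoh.of (maximalIdeal R) n (ModuleCat.of R R) t ((Ext.mk₀ w).comp η (zero_add n)) =
        f (p (w (1 : A))) := by
    obtain ⟨c, hc⟩ : ∃ c : Fin r → R, w (1 : A) = fun a ↦ Ideal.Quotient.mk _ (c a) := by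
      choose c hc using fun a ↦ Ideal.Quotient.mk_surjective ((show Fin r → A from w (1 : A)) a)
      exact ⟨c, funext fun a ↦ (hc a).symm⟩
    have hw (a : Fin r) : w ≫ ModuleCat.ofHom (LinearMap.proj a : (Fin r → A) →ₗ[R] A) =
        c a • 𝟙 _ := quotPow_end (congr($hc a))
    have hc' : w (1 : A) = ∑ a, c a • (Pi.single a (1 : A) : Fin r → A) := by
      rw [hc]
      ext b
      simp [Finset.sum_apply, Pi.single_apply, Algebra.smul_def]
      rfl
    have : (Ext.mk₀ w).comp η (zero_add n) = ∑ a, c a • x a := by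
      refine (Ext.comp_sum _ _ _).trans (Finset.sum_congr rfl fun a _ ↦ ?_)
      refine (Ext.mk₀_comp_mk₀_assoc _ _ _).trans ?_
      refine (congrArg (fun w ↦ (Ext.mk₀ w).comp (x a) (zero_add n)) (hw a)).trans ?_
      exact ext_smul_id_comp _ _
    rw [this, hc', map_sum]
    refine Eq.trans ?_ (congrArg f (map_sum p.hom _ _).symm)
    rw [map_sum]
    refine Finset.sum_congr rfl fun a _ ↦ ?_
    rw [map_smul, hx, ← map_smul]
    exact congrArg f (map_smul p.hom _ _).symm
  have hS := LinearMap.shortExact_shortComplexKer (f := p.hom) hp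
  obtain ⟨ξ, hξ⟩ := Ext.contravariant_sequence_exact₂ hS _ η (by
    have hK : maximalIdeal R ^ t ≤ Module.annihilator R (LinearMap.ker p.hom) :=
      (annihilator_pi _ r t).trans
        (LinearMap.annihilator_le_of_injective _ (LinearMap.ker p.hom).subtype_injective)
    refine hR.ext_eq_zero_of_forall (N := ModuleCat.of R (LinearMap.ker p.hom)) hK _ fun v ↦ ?_
    apply hR.of_injective
    rw [map_zero]
    refine (congrArg _ (Ext.mk₀_comp_mk₀_assoc _ _ _)).trans ((hη _).trans ?_)
    exact (congrArg f (v (1 : A)).2).trans (map_zero f))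
  refine ⟨ξ, fun v ↦ ?_⟩
  obtain ⟨y, hy⟩ := hp (v (1 : A))
  have hv : v = quotPowHom (annihilator_pi _ r t) y ≫ p := quotPow_hom_ext (by
    rw [← hy]
    exact congrArg p (quotPowHom_one (annihilator_pi _ r t) y).symm)
  rw [← hy, hv, ← Ext.mk₀_comp_mk₀_assoc]
  refine (congrArg (fun η ↦ LCoh.of _ n _ t ((Ext.mk₀ _).comp η (zero_add n))) hξ).trans ?_
  rw [hη, quotPowHom_one]

lemma baer (hR : IsGorensteinOfDim R n) :
    Module.Baer R (LCoh (maximalIdeal R) n (ModuleCat.of R R)) := by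
  intro J f
  obtain ⟨s, hs⟩ := LCoh.torsion_of_fg (LinearMap.range f)
    (LinearMap.range_eq_map f ▸ (Module.Finite.fg_top (R := R) (M := J)).map f)
  obtain ⟨k, hk⟩ := Ideal.exists_pow_inf_eq_pow_smul (maximalIdeal R) (J : Submodule R R)
  have hk := hk (k + s) (Nat.le_add_right k s)
  rw [Nat.add_sub_cancel_left] at hk
  set t := k + s
  let g : J →ₗ[R] R ⧸ maximalIdeal R ^ t := (Submodule.mkQ (maximalIdeal R ^ t)) ∘ₗ J.subtype
  have hg : LinearMap.ker g ≤ LinearMap.ker f := by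
    rintro ⟨x, hx⟩ hxg
    have hxt : x ∈ maximalIdeal R ^ t := Ideal.Quotient.eq_zero_iff_mem.mp hxg
    have hmem : x ∈ (maximalIdeal R ^ t • ⊤ ⊓ J : Submodule R R) := ⟨by simpa using hxt, hx⟩
    rw [hk] at hmem
    suffices ∃ h : x ∈ J, f ⟨x, h⟩ = 0 from this.2
    clear hxg hxt hx
    induction hmem using Submodule.smul_induction_on' with
    | smul r hr y hy =>
      refine ⟨J.mul_mem_left r hy.2, ?_⟩
      exact (map_smul f r ⟨y, hy.2⟩).trans (hs r hr _ ⟨_, rfl⟩)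
    | add a _ b _ ha hb =>
      obtain ⟨ha, ha'⟩ := ha
      obtain ⟨hb, hb'⟩ := hb
      exact ⟨J.add_mem ha hb, (map_add f ⟨a, ha⟩ ⟨b, hb⟩).trans (by rw [ha', hb', add_zero])⟩
  let N : ModuleCat.{u} R := ModuleCat.of R (J ⧸ LinearMap.ker g)
  let i : N ⟶ quotPow (maximalIdeal R) t :=
    ModuleCat.ofHom ((LinearMap.ker g).liftQ g le_rfl)
  have hi : Function.Injective i :=
    LinearMap.ker_eq_bot.mp (Submodule.ker_liftQ_eq_bot _ _ _ le_rfl)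
  have hN : maximalIdeal R ^ t ≤ Module.annihilator R N :=
    (annihilator_quotPow _ t).trans (LinearMap.annihilator_le_of_injective i.hom hi)
  obtain ⟨ξ, hξ⟩ := hR.exists_ext_of_linearMap hN ((LinearMap.ker g).liftQ f hg)
  obtain ⟨x, hx⟩ := hR.precomp_surjective (annihilator_quotPow _ t) i hi ξ
  refine ⟨LinearMap.toSpanSingleton R _ (LCoh.of _ n _ t x), fun r hr ↦ ?_⟩
  have h := hξ (quotPowHom hN (Submodule.Quotient.mk ⟨r, hr⟩))
  rw [← hx, quotPowHom_one, Ext.mk₀_comp_mk₀_assoc,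
    quotPow_end (r := r) (v := quotPowHom hN (Submodule.Quotient.mk ⟨r, hr⟩) ≫ i),
    ext_smul_id_comp, map_smul] at h
  · exact h
  · exact congrArg i (quotPowHom_one hN (Submodule.Quotient.mk ⟨r, hr⟩))

lemma isResidueHull (hR : IsGorensteinOfDim R n) :
    IsResidueHull R (LCoh (maximalIdeal R) n (ModuleCat.of R R)) where
  injective := hR.baer.injective
  torsion := LCoh.torsion
  socle := by
    obtain ⟨ψ⟩ := hR.ext_equiv
    let φ (t : ℕ) (ht : t ≠ 0) :
        quotPow (maximalIdeal R) t ⟶ ModuleCat.of R (R ⧸ maximalIdeal R) :=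
      ModuleCat.ofHom (Submodule.mapQ _ _ LinearMap.id (Ideal.pow_le_self ht))
    let y := ψ.symm 1
    have hy : y ≠ 0 := by simp [y]
    refine ⟨LCoh.of _ n _ 1 ((Ext.mk₀ (φ 1 one_ne_zero)).comp y (zero_add n)), fun h0 ↦ hy ?_,
      fun r hr ↦ ?_, fun e he ↦ ?_⟩
    · refine hR.precomp_injective (annihilator_quotPow _ 1) (φ 1 one_ne_zero) (fun z ↦ ?_) y
        (hR.of_injective 1 (h0.trans (map_zero _).symm))
      obtain ⟨z, rfl⟩ := Ideal.Quotient.mk_surjective z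
      exact ⟨Ideal.Quotient.mk _ z, rfl⟩
    · rw [← map_smul, smul_ext_quotPow_eq_zero _ _ (by rwa [pow_one]), map_zero]
    · obtain ⟨x, rfl⟩ := hR.exists_of_eq 1 e (by rwa [pow_one])
      obtain ⟨w, hw⟩ := hR.exists_of_smul_eq_zero (Ideal.pow_le_self one_ne_zero) x
        fun r hr ↦ hR.of_injective 1 (by rw [map_smul, he r hr, map_zero])
      obtain ⟨a, ha⟩ := Ideal.Quotient.mk_surjective (ψ w)
      refine ⟨a, ?_⟩
      have : w = a • y := by
        apply ψ.injective
        rw [map_smul, LinearEquiv.apply_symm_apply, ← ha, Algebra.smul_def, mul_one]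
        rfl
      rw [← hw, this, Ext.comp_smul, map_smul]

end IsGorensteinOfDim

end

section

variable {R : Type u} [CommRing R]

lemma length_hom_le_add {E : Type u} [AddCommGroup E] [Module R E]
    {N₁ N₂ N₃ : Type u}
    [AddCommGroup N₁] [AddCommGroup N₂] [AddCommGroup N₃]
    [Module R N₁] [Module R N₂] [Module R N₃] {f : N₁ →ₗ[R] N₂} {g : N₂ →ₗ[R] N₃}
    (hg : Function.Surjective g) (hfg : Function.Exact f g) :
    Module.length R (N₂ →ₗ[R] E) ≤ Module.length R (N₁ →ₗ[R] E) + Module.length R (N₃ →ₗ[R] E) := by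
  let φ := LinearMap.lcomp R E f
  rw [Module.length_eq_add_of_exact (LinearMap.ker φ).subtype φ.rangeRestrict
    (Submodule.subtype_injective _) φ.surjective_rangeRestrict
    (LinearMap.exact_iff.mpr (by simp)), add_comm]
  refine add_le_add (Module.length_le_of_injective _ (Submodule.subtype_injective _)) ?_
  have hle : LinearMap.ker φ ≤ LinearMap.range (LinearMap.lcomp R E g) := by
    intro h hh
    have hker : LinearMap.ker g ≤ LinearMap.ker h := by
      rw [LinearMap.exact_iff.mp hfg]
      rintro _ ⟨x, rfl⟩
      exact congr($hh x)
    refine ⟨(LinearMap.ker g).liftQ h hker ∘ₗ (g.quotKerEquivOfSurjective hg).symm, ?_⟩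
    ext x
    have : (g.quotKerEquivOfSurjective hg).symm (g x) = Submodule.Quotient.mk x := by
      rw [LinearEquiv.symm_apply_eq]
      rfl
    simp [this]
  exact (Module.length_le_of_injective _ (Submodule.inclusion_injective hle)).trans
    (Module.length_le_of_surjective _ (LinearMap.lcomp R E g).surjective_rangeRestrict)

namespace IsResidueHull
variable [IsLocalRing R] {E : Type u} [AddCommGroup E] [Module R E]

/-- An injective hull of the residue field is a cogenerator. -/
lemma exists_apply_ne_zero (hE : IsResidueHull R E) {M : Type u} [AddCommGroup M] [Module R M]
    {x : M} (hx : x ≠ 0) : ∃ f : M →ₗ[R] E, f x ≠ 0 := by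
  obtain ⟨e, he, hme, -⟩ := hE.socle
  let s := LinearMap.toSpanSingleton R M x
  have hs : LinearMap.ker s ≤ LinearMap.ker (LinearMap.toSpanSingleton R E e) := fun r hr ↦ by
    refine hme r (IsLocalRing.le_maximalIdeal (J := LinearMap.ker s) (fun h ↦ hx ?_) hr)
    have : (1 : R) ∈ LinearMap.ker s := h ▸ Submodule.mem_top
    simpa [s] using this
  obtain ⟨h, hh⟩ := hE.injective.out ((LinearMap.ker s).liftQ s le_rfl)
    (LinearMap.ker_eq_bot.mp (Submodule.ker_liftQ_eq_bot _ _ _ le_rfl))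
    ((LinearMap.ker s).liftQ (LinearMap.toSpanSingleton R E e) hs)
  refine ⟨h, ?_⟩
  have := hh (Submodule.Quotient.mk 1)
  simp only [Submodule.liftQ_apply, LinearMap.toSpanSingleton_apply, one_smul, s] at this
  rwa [this]

lemma exists_apply_ne_zero_of_notMem (hE : IsResidueHull R E) {M : Type u} [AddCommGroup M]
    [Module R M] {P : Submodule R M} {x : M} (hx : x ∉ P) :
    ∃ f : M →ₗ[R] E, P ≤ LinearMap.ker f ∧ f x ≠ 0 := by
  obtain ⟨f, hf⟩ := hE.exists_apply_ne_zero (x := P.mkQ x) (by simpa using hx)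
  exact ⟨f ∘ₗ P.mkQ, fun y hy ↦ by simp [(Submodule.Quotient.mk_eq_zero P).mpr hy], hf⟩

lemma length_hom_residue_le (hE : IsResidueHull R E) :
    Module.length R ((R ⧸ maximalIdeal R) →ₗ[R] E) ≤ Module.length R (R ⧸ maximalIdeal R) := by
  obtain ⟨e, he, hme, hsoc⟩ := hE.socle
  let f : (R ⧸ maximalIdeal R) →ₗ[R] E :=
    Submodule.liftQ _ (LinearMap.toSpanSingleton R E e) hme
  refine Module.length_le_of_surjective
    (Submodule.liftQ _ (LinearMap.toSpanSingleton R _ f) fun r hr ↦ ?_) fun g ↦ ?_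
  · refine LinearMap.ext fun y ↦ ?_
    obtain ⟨y, rfl⟩ := Ideal.Quotient.mk_surjective y
    change r • y • e = 0
    rw [smul_comm, hme r hr, smul_zero]
  · obtain ⟨a, ha⟩ := hsoc (g 1) fun r hr ↦ by
      rw [← map_smul, Algebra.smul_def, mul_one]
      exact (congrArg g (Ideal.Quotient.eq_zero_iff_mem.mpr hr)).trans (map_zero g)
    refine ⟨Ideal.Quotient.mk _ a, LinearMap.ext fun y ↦ ?_⟩
    obtain ⟨y, rfl⟩ := Ideal.Quotient.mk_surjective y
    change a • y • e = g (Ideal.Quotient.mk _ y)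
    rw [smul_comm, ← ha, ← map_smul, Algebra.smul_def, mul_one]
    rfl

lemma length_hom_le [IsNoetherianRing R] (hE : IsResidueHull R E) (N : Type u) [AddCommGroup N]
    [Module R N] [hN : Module.Finite R N] (t : ℕ)
    (ht : maximalIdeal R ^ t ≤ Module.annihilator R N) :
    Module.length R (N →ₗ[R] E) ≤ Module.length R N := by
  revert ht
  induction hN using IsNoetherianRing.induction_on_isQuotientEquivQuotientPrime R with
  | subsingleton N => intro _; simp [Module.length_eq_zero]
  | quotient N p f =>
    intro ht
    rw [f.annihilator_eq, Ideal.annihilator_quotient] at ht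
    have hp : p.1 = maximalIdeal R := le_antisymm (IsLocalRing.le_maximalIdeal p.2.ne_top)
      (p.2.le_of_pow_le ht)
    rw [hp] at f
    rw [f.length_eq, (f.congrLeft E R).length_eq]
    exact hE.length_hom_residue_le
  | exact N₁ N₂ N₃ f g hf hg hfg h₁ h₃ =>
    intro ht
    rw [Module.length_eq_add_of_exact f g hf hg hfg]
    exact (length_hom_le_add hg hfg).trans (add_le_add
      (h₁ (ht.trans (LinearMap.annihilator_le_of_injective f hf)))
      (h₃ (ht.trans (LinearMap.annihilator_le_of_surjective g hg))))

end IsResidueHull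

end

section

variable {R : Type u} [CommRing R]

lemma length_ne_top_of_pow_le_annihilator [IsNoetherianRing R] [IsLocalRing R] (N : Type u)
    [AddCommGroup N] [Module R N] [hN : Module.Finite R N] (t : ℕ)
    (ht : maximalIdeal R ^ t ≤ Module.annihilator R N) : Module.length R N ≠ ⊤ := by
  revert ht
  induction hN using IsNoetherianRing.induction_on_isQuotientEquivQuotientPrime R with
  | subsingleton N => intro _; simp [Module.length_eq_zero]
  | quotient N p f =>
    intro ht
    rw [f.annihilator_eq, Ideal.annihilator_quotient] at ht
    have hp : p.1 = maximalIdeal R := le_antisymm (IsLocalRing.le_maximalIdeal p.2.ne_top)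
      (p.2.le_of_pow_le ht)
    rw [hp] at f
    have : IsSimpleModule R (R ⧸ maximalIdeal R) :=
      isSimpleModule_iff_quot_maximal.mpr ⟨_, inferInstance, ⟨LinearEquiv.refl _ _⟩⟩
    rw [f.length_eq, Module.length_eq_one_iff.mpr this]
    simp
  | exact N₁ N₂ N₃ f g hf hg hfg h₁ h₃ =>
    intro ht
    rw [Module.length_eq_add_of_exact f g hf hg hfg]
    exact WithTop.add_ne_top.mpr ⟨h₁ (ht.trans (LinearMap.annihilator_le_of_injective f hf)),
      h₃ (ht.trans (LinearMap.annihilator_le_of_surjective g hg))⟩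

lemma surjective_of_injective_of_length_le {M N : Type u} [AddCommGroup M] [Module R M]
    [AddCommGroup N] [Module R N] (f : M →ₗ[R] N) (hf : Function.Injective f)
    (hM : Module.length R M ≠ ⊤) (h : Module.length R N ≤ Module.length R M) :
    Function.Surjective f := by
  rw [Module.length_eq_add_of_exact f (LinearMap.range f).mkQ hf (Submodule.mkQ_surjective _)
    (LinearMap.exact_iff.mpr (by simp))] at h
  have : Module.length R (N ⧸ LinearMap.range f) = 0 := by
    rw [← nonpos_iff_eq_zero]
    exact (ENat.add_le_add_iff_left hM).mp (by simpa using h)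
  rw [Module.length_eq_zero_iff] at this
  exact LinearMap.range_eq_top.mp (Submodule.Quotient.subsingleton_iff.mp this)

lemma finite_iff_isArtinian_of_isTorsionBySet [IsLocalRing R] (Y : Type u) [AddCommGroup Y]
    [Module R Y] (hY : Module.IsTorsionBySet R Y (maximalIdeal R)) :
    Module.Finite R Y ↔ IsArtinian R Y := by
  let := hY.module
  have : IsScalarTower R (R ⧸ maximalIdeal R) Y := hY.isScalarTower
  let := Ideal.Quotient.field (maximalIdeal R)
  have hs : Function.Surjective (algebraMap R (R ⧸ maximalIdeal R)) := Ideal.Quotient.mk_surjective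
  have : IsArtinian (R ⧸ maximalIdeal R) Y ↔ IsArtinian R Y :=
    ⟨fun _ ↦ isArtinian_of_surjective_algebraMap hs, isArtinian_of_tower R⟩
  rw [← this, ← IsSemiprimaryRing.isNoetherian_iff_isArtinian]
  refine ⟨fun h ↦ ?_, fun h ↦ ?_⟩
  · have := Module.Finite.of_restrictScalars_finite R (R ⧸ maximalIdeal R) Y
    infer_instance
  · exact Module.Finite.trans (R ⧸ maximalIdeal R) Y

lemma isTorsionBySet_residue_hom [IsLocalRing R] (X : Type u) [AddCommGroup X] [Module R X] :
    Module.IsTorsionBySet R ((R ⧸ maximalIdeal R) →ₗ[R] X) (maximalIdeal R) := by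
  intro f ⟨r, hr⟩
  refine LinearMap.ext fun y ↦ ?_
  change r • f y = 0
  obtain ⟨y, rfl⟩ := Ideal.Quotient.mk_surjective y
  rw [← map_smul, Algebra.smul_def]
  refine (congrArg f ?_).trans (map_zero f)
  exact Ideal.Quotient.eq_zero_iff_mem.mpr (Ideal.mul_mem_right y _ hr)

lemma finite_socle_of_isArtinian [IsLocalRing R] (X : Type u) [AddCommGroup X] [Module R X]
    [IsArtinian R X] :
    Module.Finite R ((R ⧸ maximalIdeal R) →ₗ[R] X) := by
  let Y := (R ⧸ maximalIdeal R) →ₗ[R] X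
  let k := R ⧸ maximalIdeal R
  have : IsArtinian R Y := isArtinian_of_injective (LinearMap.applyₗ' R (1 : k)) fun f g h ↦ by
    refine LinearMap.ext fun y ↦ ?_
    obtain ⟨y, rfl⟩ := Ideal.Quotient.mk_surjective y
    have := congrArg (y • ·) h
    change y • f 1 = y • g 1 at this
    rwa [← map_smul, ← map_smul, Algebra.smul_def, mul_one] at this
  exact (finite_iff_isArtinian_of_isTorsionBySet _ (isTorsionBySet_residue_hom X)).mpr this

namespace IsResidueHull
variable [IsLocalRing R] {E : Type u} [AddCommGroup E] [Module R E]

lemma mem_of_smul_eq_zero (hE : IsResidueHull R E) (J : Ideal R) (r : R)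
    (hr : ∀ e : E, (∀ s ∈ J, s • e = 0) → r • e = 0) : r ∈ J := by
  by_contra h
  obtain ⟨f, hf, hfr⟩ := hE.exists_apply_ne_zero_of_notMem (P := J) h
  have hfr' : f r = r • f 1 := by rw [← map_smul, smul_eq_mul, mul_one]
  refine hfr (hfr' ▸ hr _ fun s hs ↦ ?_)
  rw [← map_smul, smul_eq_mul, mul_one]
  exact hf hs

lemma eq_zero_of_smul (hE : IsResidueHull R E) (r : R) (hr : ∀ e : E, r • e = 0) : r = 0 :=
  (Submodule.mem_bot R).mp (hE.mem_of_smul_eq_zero ⊥ r fun e _ ↦ hr e)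

lemma exists_finset_of_finite (hE : IsResidueHull R E) (X : Type u) [AddCommGroup X] [Module R X]
    (h : Module.Finite R (X →ₗ[R] E)) :
    ∃ s : Finset (X →ₗ[R] E), ∀ x, (∀ f ∈ s, f x = 0) → x = 0 := by
  obtain ⟨s, hs⟩ := h.fg_top
  refine ⟨s, fun x hx ↦ ?_⟩
  by_contra hne
  obtain ⟨f, hf⟩ := hE.exists_apply_ne_zero hne
  refine hf ?_
  have hle : Submodule.span R (s : Set (X →ₗ[R] E)) ≤ LinearMap.ker (LinearMap.applyₗ' R x) :=
    Submodule.span_le.mpr hx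
  exact hle (hs ▸ Submodule.mem_top : f ∈ _)

lemma exists_finset_of_finite_socle (hE : IsResidueHull R E) (X : Type u) [AddCommGroup X]
    [Module R X]
    (hX : ∀ x : X, ∃ t, ∀ r ∈ maximalIdeal R ^ t, r • x = 0)
    (h : Module.Finite R ((R ⧸ maximalIdeal R) →ₗ[R] X)) :
    ∃ s : Finset (X →ₗ[R] E), ∀ x, (∀ f ∈ s, f x = 0) → x = 0 := by
  classical
  let k := R ⧸ maximalIdeal R
  let Y := k →ₗ[R] X
  have : IsArtinian R Y :=
    (finite_iff_isArtinian_of_isTorsionBySet _ (isTorsionBySet_residue_hom X)).mp h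
  have hmem (s : Finset (X →ₗ[R] E)) (g : Y) :
      g ∈ (⨅ f ∈ s, LinearMap.ker (LinearMap.llcomp R k X E f)) ↔ ∀ f ∈ s, f ∘ₗ g = 0 := by
    simp only [Submodule.mem_iInf, LinearMap.mem_ker]
    rfl
  let K (s : Finset (X →ₗ[R] E)) : Submodule R Y :=
    ⨅ f ∈ s, LinearMap.ker (LinearMap.llcomp R k X E f)
  obtain ⟨_, ⟨s, rfl⟩, hs⟩ := IsArtinian.set_has_minimal (Set.range K) ⟨_, ∅, rfl⟩
  have hK : K s = ⊥ := by
    refine (Submodule.eq_bot_iff _).mpr fun g hg ↦ ?_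
    by_contra hne
    obtain ⟨y, hy⟩ : ∃ y, g y ≠ 0 := by
      by_contra! hy
      exact hne (LinearMap.ext hy)
    obtain ⟨f, hf⟩ := hE.exists_apply_ne_zero hy
    have hle : K (insert f s) ≤ K s := biInf_mono fun f hf ↦ Finset.mem_insert_of_mem hf
    refine hs _ ⟨insert f s, rfl⟩ (lt_of_le_of_ne hle fun h ↦ hf ?_)
    rw [← h] at hg
    have := (hmem _ _).mp hg f (Finset.mem_insert_self f s)
    exact congr($this y)
  refine ⟨s, fun x hx ↦ ?_⟩
  by_contra hne
  obtain ⟨r, hr, hmr⟩ : ∃ r : R, r • x ≠ 0 ∧ ∀ a ∈ maximalIdeal R, a • r • x = 0 := by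
    obtain ⟨t, ht⟩ := hX x
    clear hx
    induction t generalizing x with
    | zero => exact absurd (by simpa using ht 1 (by simp)) hne
    | succ t ih =>
      by_cases h : ∀ r ∈ maximalIdeal R ^ t, r • x = 0
      · exact ih x hne h
      · push Not at h
        obtain ⟨r, hr, hrx⟩ := h
        exact ⟨r, hrx, fun a ha ↦ by
          rw [smul_smul]
          exact ht _ (by rw [pow_succ']; exact Ideal.mul_mem_mul ha hr)⟩
  let g : Y := Submodule.liftQ _ (LinearMap.toSpanSingleton R X (r • x)) hmr
  have hg : g ∈ K s := (hmem _ _).mpr fun f hf ↦ LinearMap.ext fun y ↦ by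
    obtain ⟨y, rfl⟩ := Ideal.Quotient.mk_surjective y
    change f (y • r • x) = 0
    rw [map_smul, map_smul, hx f hf, smul_zero, smul_zero]
  rw [hK, Submodule.mem_bot] at hg
  exact hr ((one_smul R _).symm.trans congr($hg 1))

variable [IsNoetherianRing R]

lemma exists_smul_of_pow (hE : IsResidueHull R E) (φ : E →ₗ[R] E) (t : ℕ) :
    ∃ r : R, ∀ e : E, (∀ s ∈ maximalIdeal R ^ t, s • e = 0) → φ e = r • e := by
  let J := maximalIdeal R ^ t
  let D : Submodule R E := Submodule.torsionBySet R E J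
  have hD (e : E) : e ∈ D ↔ ∀ s ∈ J, s • e = 0 := by simp [D, Submodule.mem_torsionBySet_iff]
  have hann : J ≤ Module.annihilator R D := fun s hs ↦ Module.mem_annihilator.mpr fun e ↦
    Subtype.ext ((hD e).mp e.2 s hs)
  have hA : Module.length R (R ⧸ J) ≠ ⊤ :=
    length_ne_top_of_pow_le_annihilator _ t (by rw [Ideal.annihilator_quotient])
  let ev : ((R ⧸ J) →ₗ[R] E) →ₗ[R] D :=
    LinearMap.codRestrict D (LinearMap.applyₗ' R (1 : R ⧸ J)) fun f ↦ (hD _).mpr fun s hs ↦ by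
      change s • f 1 = 0
      rw [← map_smul, Algebra.smul_def, mul_one]
      exact (congrArg f (Ideal.Quotient.eq_zero_iff_mem.mpr hs)).trans (map_zero f)
  have hev : Function.Surjective ev := fun e ↦
    ⟨Submodule.liftQ J (LinearMap.toSpanSingleton R E e.1) ((hD _).mp e.2),
      Subtype.ext (one_smul R e.1)⟩
  have hDA : Module.length R D ≤ Module.length R (R ⧸ J) :=
    (Module.length_le_of_surjective ev hev).trans
      (hE.length_hom_le _ t (by rw [Ideal.annihilator_quotient]))
  have hDfin : Module.Finite R D := by
    have := (Module.length_ne_top_iff (R := R) (M := D)).mp (ne_top_of_le_ne_top hA hDA)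
    have := (isFiniteLength_iff_isNoetherian_isArtinian.mp this).1
    infer_instance
  let g : (R ⧸ J) →ₗ[R] (D →ₗ[R] E) :=
    Submodule.liftQ J (LinearMap.toSpanSingleton R _ D.subtype) fun s hs ↦
      LinearMap.ext fun e ↦ (hD e).mp e.2 s hs
  have hg : Function.Injective g := by
    refine LinearMap.ker_eq_bot.mp ((Submodule.eq_bot_iff _).mpr fun x hx ↦ ?_)
    obtain ⟨r, rfl⟩ := Ideal.Quotient.mk_surjective x
    refine Ideal.Quotient.eq_zero_iff_mem.mpr (hE.mem_of_smul_eq_zero J r fun e he ↦ ?_)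
    exact congr($hx ⟨e, (hD e).mpr he⟩)
  obtain ⟨x, hx⟩ := surjective_of_injective_of_length_le g hg hA
    ((hE.length_hom_le D t hann).trans hDA) (φ ∘ₗ D.subtype)
  obtain ⟨r, rfl⟩ := Ideal.Quotient.mk_surjective x
  exact ⟨r, fun e he ↦ congr($hx.symm ⟨e, (hD e).mpr he⟩)⟩

/-- Over a complete ring, all endomorphisms of the injective hull are scalars. -/
lemma exists_smul (hE : IsResidueHull R E) [hC : IsAdicComplete (maximalIdeal R) R]
    (φ : E →ₗ[R] E) : ∃ r : R, ∀ e, φ e = r • e := by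
  choose r hr using hE.exists_smul_of_pow φ
  obtain ⟨L, hL⟩ := hC.toIsPrecomplete.prec (f := r) fun {a b} hab ↦ by
    rw [SModEq.sub_mem, smul_eq_mul, Ideal.mul_top]
    refine hE.mem_of_smul_eq_zero _ _ fun e he ↦ ?_
    rw [sub_smul, ← hr a e he, ← hr b e fun s hs ↦ he s (Ideal.pow_le_pow_right hab hs), sub_self]
  refine ⟨L, fun e ↦ ?_⟩
  obtain ⟨t, ht⟩ := hE.torsion e
  have := hL t
  rw [SModEq.sub_mem, smul_eq_mul, Ideal.mul_top] at this
  rw [hr t e ht, ← sub_eq_zero, ← sub_smul, ht _ this]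

lemma isArtinian (hE : IsResidueHull R E) [IsAdicComplete (maximalIdeal R) R] :
    IsArtinian R E := by
  have : StrictAnti fun P : Submodule R E ↦ Module.annihilator R P := by
    intro P Q hPQ
    refine lt_of_le_of_ne (fun r hr ↦ ?_) fun h ↦ hPQ.not_ge fun e he ↦ ?_
    · exact Module.mem_annihilator.mpr fun e ↦
        Subtype.ext congr(($(Module.mem_annihilator.mp hr ⟨e.1, hPQ.le e.2⟩)).1)
    · by_contra hne
      obtain ⟨f, hf, hfe⟩ := hE.exists_apply_ne_zero_of_notMem hne
      obtain ⟨r, hr⟩ := hE.exists_smul f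
      have hrP : r ∈ Module.annihilator R P := Module.mem_annihilator.mpr fun x ↦
        Subtype.ext ((hr x).symm.trans (hf x.2))
      replace hrP : r ∈ Module.annihilator R Q := h.ge hrP
      exact hfe ((hr e).trans congr(($(Module.mem_annihilator.mp hrP ⟨e, he⟩)).1))
  exact this.wellFoundedLT

section Cogenerated
variable [IsAdicComplete (maximalIdeal R) R] (X : Type u) [AddCommGroup X] [Module R X]

lemma finite_hom_of_finset (hE : IsResidueHull R E) (s : Finset (X →ₗ[R] E))
    (hs : ∀ x, (∀ f ∈ s, f x = 0) → x = 0) : Module.Finite R (X →ₗ[R] E) := by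
  classical
  refine ⟨⟨s, eq_top_iff.mpr fun g _ ↦ ?_⟩⟩
  have := hE.injective
  obtain ⟨h, hh⟩ := hE.injective.out (LinearMap.pi fun f : s ↦ f.1) (fun x y hxy ↦ by
    rw [← sub_eq_zero]
    exact hs _ fun f hf ↦ by rw [map_sub, sub_eq_zero]; exact congrFun hxy ⟨f, hf⟩) g
  choose r hr using fun f : s ↦ hE.exists_smul (h ∘ₗ LinearMap.single R (fun _ ↦ E) f)
  have : g = ∑ f : s, r f • f.1 := LinearMap.ext fun x ↦ by
    rw [← hh x, LinearMap.sum_apply, ← Finset.univ_sum_single (LinearMap.pi _ x), map_sum]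
    exact Finset.sum_congr rfl fun f _ ↦ hr f _
  rw [this]
  exact sum_mem fun f _ ↦ Submodule.smul_mem _ _ (Submodule.subset_span f.2)

lemma isArtinian_of_finset (hE : IsResidueHull R E) (s : Finset (X →ₗ[R] E))
    (hs : ∀ x, (∀ f ∈ s, f x = 0) → x = 0) : IsArtinian R X := by
  have := hE.isArtinian
  refine isArtinian_of_injective (LinearMap.pi fun f : s ↦ f.1) fun x y hxy ↦ ?_
  rw [← sub_eq_zero]
  exact hs _ fun f hf ↦ by rw [map_sub, sub_eq_zero]; exact congrFun hxy ⟨f, hf⟩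

lemma finite_hom_iff_finite_socle (hE : IsResidueHull R E)
    (hX : ∀ x : X, ∃ t, ∀ r ∈ maximalIdeal R ^ t, r • x = 0) :
    Module.Finite R (X →ₗ[R] E) ↔ Module.Finite R ((R ⧸ maximalIdeal R) →ₗ[R] X) := by
  refine ⟨fun h ↦ ?_, fun h ↦ ?_⟩
  · obtain ⟨s, hs⟩ := hE.exists_finset_of_finite X h
    have := hE.isArtinian_of_finset X s hs
    exact finite_socle_of_isArtinian X
  · obtain ⟨s, hs⟩ := hE.exists_finset_of_finite_socle X hX h
    exact hE.finite_hom_of_finset X s hs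

lemma finite_socle_iff_isArtinian (hE : IsResidueHull R E)
    (hX : ∀ x : X, ∃ t, ∀ r ∈ maximalIdeal R ^ t, r • x = 0) :
    Module.Finite R ((R ⧸ maximalIdeal R) →ₗ[R] X) ↔ IsArtinian R X := by
  refine ⟨fun h ↦ ?_, fun _ ↦ finite_socle_of_isArtinian X⟩
  obtain ⟨s, hs⟩ := hE.exists_finset_of_finite_socle X hX h
  exact hE.isArtinian_of_finset X s hs

end Cogenerated

end IsResidueHull

end

section

open CategoryTheory.Abelian (Ext)
variable {R : Type u} [CommRing R]

lemma LCoh.mapH_smul_id {J : Ideal R} {M : ModuleCat.{u} R} {j : ℕ} (r : R) (z : LCoh J j M) :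
    mapH J (r • 𝟙 M) j z = r • z := by
  rw [mapH, Ext.mk₀_smul, post_smul, post_id]

lemma exists_smul_id (f : ModuleCat.of R R ⟶ ModuleCat.of R R) : ∃ r : R, f = r • 𝟙 _ :=
  ⟨f (1 : R), by ext; simp⟩

lemma freeMod_hom_ext {ι : Type u} {M : ModuleCat.{u} R} {f g : freeMod R ι ⟶ M}
    (h : ∀ i, freeι R i ≫ f = freeι R i ≫ g) : f = g := by
  refine ModuleCat.hom_ext (Finsupp.lhom_ext' fun i ↦ ?_)
  exact congrArg ModuleCat.Hom.hom (h i)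

/-- A linear map defined on the source of a linear map `f`, and vanishing on its kernel, with
values in an injective module extends along `f`. -/
lemma exists_extension {E : Type u} [AddCommGroup E] [Module R E] (hE : Module.Injective R E)
    {M N : Type u} [AddCommGroup M] [Module R M] [AddCommGroup N] [Module R N]
    (f : M →ₗ[R] N) (g : M →ₗ[R] E) (h : LinearMap.ker f ≤ LinearMap.ker g) :
    ∃ g' : N →ₗ[R] E, g' ∘ₗ f = g := by
  obtain ⟨g', hg'⟩ := hE.out ((LinearMap.ker f).liftQ f le_rfl)
    (LinearMap.ker_eq_bot.mp (Submodule.ker_liftQ_eq_bot _ _ _ le_rfl))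
    ((LinearMap.ker f).liftQ g h)
  exact ⟨g', LinearMap.ext fun x ↦ hg' (Submodule.Quotient.mk x)⟩

namespace LCoh
variable {J : Ideal R} {S : ShortComplex (ModuleCat.{u} R)} {B : ModuleCat.{u} R} {i j n : ℕ}

/-- Dimension shifting for the injectivity of the duality map. -/
lemma postₗ_injective_of_shortExact (hS : S.ShortExact) (hE : Module.Injective R (LCoh J n B))
    (h' : j + 1 + i = n) (h : j + (i + 1) = n) (h₂ : ∀ ξ : Ext.{u} S.X₂ B (i + 1), ξ = 0)
    (h₁ : Function.Injective (postₗ J S.X₁ B h')) (hs : Function.Surjective (postₗ J S.X₂ B h')) :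
    Function.Injective (postₗ J S.X₃ B h) := by
  refine (injective_iff_map_eq_zero _).mpr fun ξ hξ ↦ ?_
  obtain ⟨η, rfl⟩ := Ext.contravariant_sequence_exact₃ hS B ξ (h₂ _) (add_comm 1 i)
  have hle : LinearMap.ker (mapH J S.f (j + 1)) ≤ LinearMap.ker (post J η h') := by
    intro z hz
    obtain ⟨w, rfl⟩ := exact₁ hS rfl z hz
    exact (post_comp hS.extClass η (add_comm 1 i) rfl h' w).symm.trans congr($hξ w)
  obtain ⟨ψ, hψ⟩ := exists_extension hE _ _ hle
  obtain ⟨ζ, rfl⟩ := hs ψ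
  have : η = (Ext.mk₀ S.f).comp ζ (zero_add i) := by
    refine h₁ (hψ.symm.trans (LinearMap.ext fun z ↦ ?_))
    exact (post_comp (Ext.mk₀ S.f) ζ (zero_add i) (add_zero (j + 1)) h' z).symm
  rw [this, hS.extClass_comp_assoc]

/-- Dimension shifting for the surjectivity of the duality map. -/
lemma postₗ_surjective_of_shortExact (hS : S.ShortExact) (hE : Module.Injective R (LCoh J n B))
    (h' : j + 1 + i = n) (h : j + (i + 1) = n) (h₂ : Subsingleton (LCoh J j S.X₂))
    (h₁ : Function.Surjective (postₗ J S.X₁ B h')) :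
    Function.Surjective (postₗ J S.X₃ B h) := by
  intro φ
  have hle : LinearMap.ker (post J hS.extClass (Eq.refl (j + 1))) ≤ LinearMap.ker φ := by
    intro z hz
    obtain ⟨w, rfl⟩ := exact₃ hS rfl z hz
    rw [Subsingleton.elim w 0, map_zero]
    exact zero_mem _
  obtain ⟨ψ, hψ⟩ := exists_extension hE _ _ hle
  obtain ⟨η, rfl⟩ := h₁ ψ
  refine ⟨hS.extClass.comp η (add_comm 1 i), ?_⟩
  rw [← hψ]
  exact LinearMap.ext fun z ↦ post_comp hS.extClass η (add_comm 1 i) rfl h' z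

end LCoh

namespace IsGorensteinOfDim
variable [IsNoetherianRing R] [IsLocalRing R] {n : ℕ}

lemma eq_zero_of_mapH (hR : IsGorensteinOfDim R n) {M : ModuleCat.{u} R}
    (f : M ⟶ ModuleCat.of R R) (hf : LCoh.mapH (maximalIdeal R) f n = 0) : f = 0 := by
  have hS := freeCover_shortExact M
  have := hS.epi_g
  rw [← cancel_epi (freeCover R M).g, comp_zero]
  refine freeMod_hom_ext fun i ↦ ?_
  obtain ⟨r, hr⟩ := exists_smul_id (freeι R i ≫ (freeCover R M).g ≫ f)
  rw [comp_zero, hr, hR.isResidueHull.eq_zero_of_smul r fun e ↦ ?_, zero_smul]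
  rw [← LCoh.mapH_smul_id, ← hr, LCoh.mapH_comp, LCoh.mapH_comp, hf, LinearMap.zero_apply]

variable [IsAdicComplete (maximalIdeal R) R]

lemma exists_mapH_freeMod (hR : IsGorensteinOfDim R n) {ι : Type u}
    (φ : LCoh (maximalIdeal R) n (freeMod R ι) →ₗ[R] LCoh (maximalIdeal R) n (ModuleCat.of R R)) :
    ∃ f : freeMod R ι ⟶ ModuleCat.of R R, LCoh.mapH (maximalIdeal R) f n = φ := by
  choose r hr using fun i ↦
    hR.isResidueHull.exists_smul (φ ∘ₗ LCoh.mapH (maximalIdeal R) (freeι R i) n)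
  let f : freeMod R ι ⟶ ModuleCat.of R R := ModuleCat.ofHom (Finsupp.linearCombination R r)
  have hf (i : ι) : freeι R i ≫ f = r i • 𝟙 _ := by
    ext
    simp [freeι, f]
  refine ⟨f, LinearMap.ext fun z ↦ ?_⟩
  have hle : ⨆ i, LinearMap.range (LCoh.mapH (maximalIdeal R) (freeι R i) n) ≤
      LinearMap.eqLocus (LCoh.mapH (maximalIdeal R) f n) φ := by
    refine iSup_le fun i ↦ ?_
    rintro _ ⟨e, rfl⟩
    refine (LCoh.mapH_comp _ _ _ _).symm.trans ?_
    rw [hf, LCoh.mapH_smul_id]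
    exact (hr i e).symm
  exact hle (LCoh.mem_iSup_freeMod z)

lemma exists_mapH (hR : IsGorensteinOfDim R n) {M : ModuleCat.{u} R}
    (φ : LCoh (maximalIdeal R) n M →ₗ[R] LCoh (maximalIdeal R) n (ModuleCat.of R R)) :
    ∃ f : M ⟶ ModuleCat.of R R, LCoh.mapH (maximalIdeal R) f n = φ := by
  have hS := freeCover_shortExact M
  obtain ⟨g, hg⟩ := hR.exists_mapH_freeMod (φ ∘ₗ LCoh.mapH (maximalIdeal R) (freeCover R M).g n)
  have hg0 : (freeCover R M).f ≫ g = 0 := by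
    refine hR.eq_zero_of_mapH _ (LinearMap.ext fun z ↦ ?_)
    rw [LCoh.mapH_comp, hg, LinearMap.comp_apply, ← LCoh.mapH_comp, (freeCover R M).zero]
    simp [LCoh.mapH, LCoh.post_zero]
  have := hS.epi_g
  refine ⟨hS.exact.desc g hg0, LinearMap.ext fun z ↦ ?_⟩
  have := hR.LCoh_subsingleton_succ (freeCover R M).X₁
  obtain ⟨w, rfl⟩ := LCoh.exact₃ hS rfl z (Subsingleton.elim _ _)
  refine (LCoh.mapH_comp _ _ _ _).symm.trans ?_
  rw [hS.exact.g_desc, hg, LinearMap.comp_apply]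

/-- **Local duality** over a complete Gorenstein local ring. -/
theorem localDuality (hR : IsGorensteinOfDim R n) {i j : ℕ} (h : j + i = n)
    (M : ModuleCat.{u} R) :
    Function.Bijective (LCoh.postₗ (maximalIdeal R) M (ModuleCat.of R R) h) := by
  have hE := hR.isResidueHull.injective
  induction i generalizing j M with
  | zero =>
    obtain rfl : j = n := h
    refine ⟨(injective_iff_map_eq_zero _).mpr fun ξ hξ ↦ ?_, fun φ ↦ ?_⟩
    · obtain ⟨f, rfl⟩ := (Ext.mk₀_bijective _ _).2 ξ
      rw [hR.eq_zero_of_mapH f hξ, Ext.mk₀_zero]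
    · obtain ⟨f, hf⟩ := hR.exists_mapH φ
      exact ⟨Ext.mk₀ f, hf⟩
  | succ i ih =>
    have h' : j + 1 + i = n := by lia
    have hS := freeCover_shortExact M
    have hF := hR.LCoh_freeMod_subsingleton M j (by lia)
    exact ⟨LCoh.postₗ_injective_of_shortExact hS hE h' h (fun _ ↦ Ext.eq_zero_of_projective _)
      (ih h' _).1 (ih h' _).2, LCoh.postₗ_surjective_of_shortExact hS hE h' h hF (ih h' _).2⟩

end IsGorensteinOfDim

end

/-- Let `(R, 𝔪, k)` be a complete `n`-dimensional Gorenstein local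
ring and `I ⊆ R` an ideal with `c = height I` and `d = dim R/I`.  The following are
equivalent: (i) `Ext^c_R(H^c_I(R), R)` is a finitely generated `R`-module;
(ii) `dim_k Hom_R(k, H^d_𝔪(H^c_I(R))) < ∞`; (iii) `H^d_𝔪(H^c_I(R))` is Artinian. -/
theorem ext_finite_iff_hom_finite_iff_artinian
    (R : Type u) [CommRing R] [IsLocalRing R]
    (hGor : IsGorensteinLocalRing R) (hComplete : IsAdicComplete (maximalIdeal R) R)
    (n : ℕ) (hn : ringKrullDim R = n)
    (I : Ideal R) (c d : ℕ) (hc : idealHeight R I = c)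
    (hd : ringKrullDim (R ⧸ I) = d) :
    (Module.Finite R
        ↥(ExtM R c (LC R I c (ModuleCat.of R R)) (ModuleCat.of R R)) ↔
      Module.Finite R ((R ⧸ maximalIdeal R) →ₗ[R]
        ↥(LC R (maximalIdeal R) d (LC R I c (ModuleCat.of R R))))) ∧
    (Module.Finite R ((R ⧸ maximalIdeal R) →ₗ[R]
        ↥(LC R (maximalIdeal R) d (LC R I c (ModuleCat.of R R)))) ↔
      IsArtinian R ↥(LC R (maximalIdeal R) d (LC R I c (ModuleCat.of R R)))) := by
  obtain ⟨hN, n', hn', hvan, ⟨e⟩⟩ := hGor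
  obtain rfl : n' = n := by exact_mod_cast hn'.symm.trans hn
  have hR : IsGorensteinOfDim R n' :=
    { dim := hn
      ext_eq_zero := fun i hi ↦
        have := hvan i hi
        (extEquiv _ _ i).symm.toEquiv.subsingleton
      ext_equiv := ⟨(extEquiv _ _ n').symm.trans e⟩ }
  have hE := hR.isResidueHull
  have hcd : d + c = n' := (add_comm d c).trans (hR.idealHeight_add I c d hc hd)
  generalize LC R I c (ModuleCat.of R R) = M
  let X := LCoh (maximalIdeal R) d M
  let eX : X ≃ₗ[R] LC R (maximalIdeal R) d M := lcohEquiv (maximalIdeal R) d M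
  let eExt := (extEquiv M (ModuleCat.of R R) c).trans
    (LinearEquiv.ofBijective _ (hR.localDuality hcd M))
  let eSoc := LinearEquiv.congrRight (M := R ⧸ maximalIdeal R) eX
  have hX : ∀ x : X, ∃ t, ∀ r ∈ maximalIdeal R ^ t, r • x = 0 := LCoh.torsion
  exact ⟨(Module.Finite.equiv_iff eExt).trans
      ((hE.finite_hom_iff_finite_socle X hX).trans (Module.Finite.equiv_iff eSoc)),
    (Module.Finite.equiv_iff eSoc).symm.trans
      ((hE.finite_socle_iff_isArtinian X hX).trans eX.isArtinian_iff)⟩
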